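/- arXiv:1801.00179 — 2 statements merged into one kernel-verified Lean document; each statement's English description precedes it below -/
import Mathlib

section
/- Let G be a simple graph in which every vertex has degree at least 3. If |G| is 6-arc connected, then G is 3-regular, G is 3-connected, and there is no set of 6 edges of G whose removal disconnects G into 4 or more components. -/
open Topology

noncomputable section

variable {V : Type*}

open Classical in
/-- The Dirac function marking a vertex: the point of `|G|` corresponding to vertex `v`. -/
noncomputable def vertexPoint (v : V) : V → ℝ := fun u => if u = v then 1 else 0

open Classical in
/-- The point of `|G|` lying on the edge `vw` at parameter `t` (measured from `v` towards `w`). -/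
noncomputable def edgePoint (v w : V) (t : ℝ) : V → ℝ :=
  fun u => (if u = v then 1 - t else 0) + (if u = w then t else 0)

/-- The geometric realization `|G|` of a simple graph `G`, realized as the set of
formal convex combinations of adjacent pairs of vertices; each closed edge carries
its usual topology as a copy of `[0,1]`. -/
def GraphRealization (G : SimpleGraph V) : Set (V → ℝ) :=
  {x | (∃ v, x = vertexPoint v) ∨
    ∃ v w t, G.Adj v w ∧ t ∈ Set.Icc (0 : ℝ) 1 ∧ x = edgePoint v w t}

/-- A subset of a topological space is an arc if it is homeomorphic to `[0,1]`. -/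
def IsArc {X : Type*} [TopologicalSpace X] (A : Set X) : Prop :=
  Nonempty (↥A ≃ₜ ↥unitInterval)

/-- A space is `n`-arc connected if any at most `n` points lie on a common arc. -/
def NArcConn (X : Type*) [TopologicalSpace X] (n : ℕ) : Prop :=
  ∀ S : Finset X, S.card ≤ n → ∃ A : Set X, IsArc A ∧ ↑S ⊆ A

/-- The unit circle in the plane. -/
def unitCircleSet : Set (ℝ × ℝ) := {p | p.1 ^ 2 + p.2 ^ 2 = 1}

/-- A subset of a topological space is a simple closed curve if homeomorphic to the circle. -/
def IsSimpleClosedCurve {X : Type*} [TopologicalSpace X] (C : Set X) : Prop :=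
  Nonempty (↥C ≃ₜ ↥unitCircleSet)

/-- A space is `n`-circle connected if any at most `n` points lie on a common
simple closed curve. -/
def NCircleConn (X : Type*) [TopologicalSpace X] (n : ℕ) : Prop :=
  ∀ S : Finset X, S.card ≤ n → ∃ C : Set X, IsSimpleClosedCurve C ∧ ↑S ⊆ C

/-- A space is `n`-strongly arc connected if any list of at most `n` points is contained
in an arc, the points appearing along the arc in the listed order. -/
def NStrongArcConn (X : Type*) [TopologicalSpace X] (n : ℕ) : Prop :=
  ∀ l : List X, l.length ≤ n →
    ∃ f : ↥unitInterval → X, Topology.IsEmbedding f ∧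
      ∃ t : Fin l.length → ↥unitInterval, Monotone t ∧ ∀ i, f (t i) = l.get i

/-- A graph is `k`-connected if removing fewer than `k` vertices leaves it connected. -/
def KConnected (G : SimpleGraph V) (k : ℕ) : Prop :=
  ∀ S : Set V, S.encard < (k : ℕ∞) → (G.induce (Sᶜ : Set V)).Connected

/-- A graph is cyclically connected if any two vertices lie on a common cycle. -/
def CyclicallyConnected (G : SimpleGraph V) : Prop :=
  ∀ v w : V, ∃ (u : V) (c : G.Walk u u), c.IsCycle ∧ v ∈ c.support ∧ w ∈ c.support

/-- The circle of radius `r` centered at `c` in the plane. -/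
def circleAt (c : ℝ × ℝ) (r : ℝ) : Set (ℝ × ℝ) :=
  {p | (p.1 - c.1) ^ 2 + (p.2 - c.2) ^ 2 = r ^ 2}

/-- The horizontal segment at height `y` from abscissa `a` to `b`. -/
def hSeg (y a b : ℝ) : Set (ℝ × ℝ) := {p | p.2 = y ∧ a ≤ p.1 ∧ p.1 ≤ b}

/-- The θ-curve: unit circle together with horizontal diameter. -/
def thetaSet : Set (ℝ × ℝ) := circleAt (0, 0) 1 ∪ hSeg 0 (-1) 1

/-- Figure-eight: two unit circles meeting at the origin. -/
def figureEightSet : Set (ℝ × ℝ) := circleAt (-1, 0) 1 ∪ circleAt (1, 0) 1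

/-- Lollipop: unit circle with the segment from `(1,0)` to `(2,0)` attached. -/
def lollipopSet : Set (ℝ × ℝ) := circleAt (0, 0) 1 ∪ hSeg 0 1 2

/-- Lollipop with its free endpoint removed. -/
def openLollipopSet : Set (ℝ × ℝ) := lollipopSet \ {(2, 0)}

/-- Dumbbell: two disjoint unit circles joined by a segment. -/
def dumbbellSet : Set (ℝ × ℝ) := circleAt (-2, 0) 1 ∪ circleAt (2, 0) 1 ∪ hSeg 0 (-1) 1

/-- Happy-face curve: two circles meeting at a point, joined by a further arc. -/
def happyFaceSet : Set (ℝ × ℝ) :=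
  circleAt (-1, 0) 1 ∪ circleAt (1, 0) 1 ∪ {p | p.1 ^ 2 + p.2 ^ 2 = 4 ∧ p.2 ≤ 0}

/-- Baguette curve: two disjoint circles joined by two disjoint arcs. -/
def baguetteSet : Set (ℝ × ℝ) :=
  circleAt (-3, 0) 1 ∪ circleAt (3, 0) 1 ∪ hSeg 0 (-2) 2 ∪ hSeg 1 (-3) 3

/-- A graph is a basic 4-ac graph iff its realization is homeomorphic to a circle,
a θ-curve, a happy-face curve or a baguette curve (this captures precisely the
subdivisions of those four graphs). -/
def IsBasicFourAC {W : Type*} (H : SimpleGraph W) : Prop :=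
  Nonempty (↥(GraphRealization H) ≃ₜ ↥unitCircleSet) ∨
  Nonempty (↥(GraphRealization H) ≃ₜ ↥thetaSet) ∨
  Nonempty (↥(GraphRealization H) ≃ₜ ↥happyFaceSet) ∨
  Nonempty (↥(GraphRealization H) ≃ₜ ↥baguetteSet)

/-- A chain-graph decomposition of the connected graph `G`: links indexed by an
interval `J` of `ℤ`, non-consecutive links are disjoint, consecutive links share
exactly one vertex. -/
structure IsChainGraph (G : SimpleGraph V) (J : Set ℤ) (L : ℤ → G.Subgraph) : Prop where
  connected : G.Connected
  ordConnected : J.OrdConnected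
  nonempty : J.Nonempty
  cover : (⨆ i ∈ J, L i) = (⊤ : G.Subgraph)
  sep : ∀ i ∈ J, ∀ j ∈ J, i + 1 < j → (L i).verts ∩ (L j).verts = ∅
  link : ∀ i ∈ J, i + 1 ∈ J → ∃ v, (L i).verts ∩ (L (i + 1)).verts = {v}

/-- A cut-vertex: a vertex whose removal disconnects the graph. -/
def IsCutVertex (G : SimpleGraph V) (v : V) : Prop :=
  ¬ (G.induce ({v}ᶜ : Set V)).Connected

/-- A block: a maximal 2-connected subgraph. -/
def IsBlock (G : SimpleGraph V) (H : G.Subgraph) : Prop :=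
  KConnected H.coe 2 ∧ ∀ H' : G.Subgraph, H ≤ H' → KConnected H'.coe 2 → H' = H

/-- The block graph of `G`: the bipartite graph on cut-vertices and blocks, a cut-vertex
being adjacent to the blocks containing it. -/
def BlockGraph (G : SimpleGraph V) :
    SimpleGraph ({v : V // IsCutVertex G v} ⊕ {H : G.Subgraph // IsBlock G H}) :=
  SimpleGraph.fromRel fun a b =>
    ∃ (c : {v : V // IsCutVertex G v}) (B : {H : G.Subgraph // IsBlock G H}),
      a = Sum.inl c ∧ b = Sum.inr B ∧ (c : V) ∈ (B : G.Subgraph).verts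

/-- An `A`–`B` path: a path starting in `A`, ending in `B` and meeting `A ∪ B` only
in these two endvertices. -/
structure ABPath (G : SimpleGraph V) (A B : Set V) where
  first : V
  last : V
  walk : G.Walk first last
  isPath : walk.IsPath
  firstA : first ∈ A
  lastB : last ∈ B
  meetA : ∀ v ∈ walk.support, v ∈ A → v = first
  meetB : ∀ v ∈ walk.support, v ∈ B → v = last

/-- A family of pairwise vertex-disjoint paths. -/
def PathFamilyDisjoint {G : SimpleGraph V} {A B : Set V} {k : ℕ}
    (P : Fin k → ABPath G A B) : Prop :=
  ∀ i j, i ≠ j → ∀ v, v ∈ (P i).walk.support → v ∉ (P j).walk.support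

/-- The set of vertices used by a family of paths. -/
def familySupport {G : SimpleGraph V} {A B : Set V} {k : ℕ}
    (P : Fin k → ABPath G A B) : Set V :=
  {v | ∃ i, v ∈ (P i).walk.support}

/-- The set of edges used by a family of paths. -/
def familyEdges {G : SimpleGraph V} {A B : Set V} {k : ℕ}
    (P : Fin k → ABPath G A B) : Set (Sym2 V) :=
  {e | ∃ i, e ∈ (P i).walk.edges}

/-- A walk `W` (with no repeated edges) is alternating with respect to the disjoint
path family `P`: it starts in `A` off the paths; repeated vertices lie on paths of the
family; upon hitting a path by a new edge it follows that path backwards for at least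
one edge; and it traverses edges of paths of the family only backwards. -/
structure IsAlternatingWalk {G : SimpleGraph V} {A B : Set V} {k : ℕ}
    (P : Fin k → ABPath G A B) {x y : V} (W : G.Walk x y) : Prop where
  trail : W.IsTrail
  startA : x ∈ A
  startOff : x ∉ familySupport P
  repeats : ∀ v, List.Duplicate v W.support → v ∈ familySupport P
  follows : ∀ (i : ℕ) (hi : i < W.darts.length) (j : Fin k),
      (W.darts.get ⟨i, hi⟩).snd ∈ (P j).walk.support →
      (W.darts.get ⟨i, hi⟩).edge ∉ (P j).walk.edges →
      ∃ h : i + 1 < W.darts.length, (W.darts.get ⟨i + 1, h⟩).symm ∈ (P j).walk.darts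
  backward : ∀ d ∈ W.darts, ∀ j : Fin k,
      d.edge ∈ (P j).walk.edges → d.symm ∈ (P j).walk.darts

end

section Realization

variable {V : Type*} {G : SimpleGraph V} {x : V → ℝ}

open Classical in
/-- The midpoint of an edge in the geometric realization. -/
noncomputable def edgeMidpoint (e : Sym2 V) : V → ℝ := fun u => if u ∈ e then 1 / 2 else 0

theorem edgeMidpoint_injective : Function.Injective (edgeMidpoint : Sym2 V → V → ℝ) := by
  intro e e' h
  refine Sym2.ext fun u => ?_
  have := congrFun h u
  by_cases h1 : u ∈ e <;> by_cases h2 : u ∈ e' <;> simp_all [edgeMidpoint]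

theorem edgeMidpoint_le (e : Sym2 V) (u : V) : edgeMidpoint e u ≤ 1 / 2 := by
  unfold edgeMidpoint; split_ifs <;> norm_num

theorem edgeMidpoint_mem {e : Sym2 V} (he : e ∈ G.edgeSet) :
    edgeMidpoint e ∈ GraphRealization G := by
  induction e with
  | _ v w =>
    rw [SimpleGraph.mem_edgeSet] at he
    refine Or.inr ⟨v, w, 1 / 2, he, by norm_num, ?_⟩
    have := he.ne
    funext u
    by_cases h1 : u = v <;> by_cases h2 : u = w <;>
      simp_all [edgeMidpoint, edgePoint, Sym2.mem_iff]
    norm_num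

/-- Points of the realization are vertices or lie in the interior of an edge. -/
theorem GraphRealization.cases (hx : x ∈ GraphRealization G) :
    (∃ v, x = vertexPoint v) ∨
      ∃ v w, G.Adj v w ∧ 0 < x v ∧ 0 < x w ∧ x v + x w = 1 ∧ ∀ u, u ≠ v → u ≠ w → x u = 0 := by
  rcases hx with h | ⟨v, w, t, hvw, ⟨h0, h1⟩, rfl⟩
  · exact Or.inl h
  have hne := hvw.ne
  have hne' := hvw.ne'
  rcases h0.eq_or_lt with rfl | h0
  · left; exact ⟨v, by funext u; simp [edgePoint, vertexPoint]⟩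
  rcases h1.eq_or_lt with rfl | h1
  · left; exact ⟨w, by funext u; simp [edgePoint, vertexPoint]⟩
  right
  refine ⟨v, w, hvw, ?_, ?_, ?_, ?_⟩
  · simp [edgePoint, hne, h1]
  · simp [edgePoint, hne', h0]
  · simp [edgePoint, hne, hne']
  · intro u hu hu'; simp [edgePoint, hu, hu']

theorem GraphRealization.eq_edgeMidpoint {v w : V} (hx : x ∈ GraphRealization G) (hvw : v ≠ w)
    (hv : x v = 1 / 2) (hw : 0 < x w) : x = edgeMidpoint s(v, w) := by
  rcases GraphRealization.cases hx with ⟨a, rfl⟩ | ⟨a, b, hab, ha, hb, hsum, h0⟩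
  · simp only [vertexPoint] at hv
    split_ifs at hv <;> norm_num at hv
  · have hne := hab.ne
    have hv' : v = a ∨ v = b := by
      by_contra! h
      linarith [h0 v h.1 h.2]
    have hw' : w = a ∨ w = b := by
      by_contra! h
      linarith [h0 w h.1 h.2]
    funext u
    unfold edgeMidpoint
    rcases hv' with rfl | rfl <;> rcases hw' with rfl | rfl <;> try exact absurd rfl hvw
    all_goals
      split_ifs with h
      · rcases Sym2.mem_iff.1 h with rfl | rfl <;> linarith
      · rw [Sym2.mem_iff, not_or] at h
        first
          | exact h0 u h.1 h.2
          | exact h0 u h.2 h.1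

theorem GraphRealization.add_eq_one {v w : V} (hx : x ∈ GraphRealization G) (hvw : v ≠ w)
    (hv : 0 < x v) (hw : 0 < x w) : x v + x w = 1 := by
  rcases GraphRealization.cases hx with ⟨a, rfl⟩ | ⟨a, b, hab, ha, hb, hsum, h0⟩
  · simp only [vertexPoint] at hv hw
    split_ifs at hv hw <;> simp_all
  · have hv' : v = a ∨ v = b := by
      by_contra! h
      linarith [h0 v h.1 h.2]
    have hw' : w = a ∨ w = b := by
      by_contra! h
      linarith [h0 w h.1 h.2]
    rcases hv' with rfl | rfl <;> rcases hw' with rfl | rfl <;> first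
      | exact absurd rfl hvw
      | linarith

theorem GraphRealization.not_three_pos {u v w : V} (hx : x ∈ GraphRealization G) (huv : u ≠ v)
    (huw : u ≠ w) (hvw : v ≠ w) (hu : 0 < x u) (hv : 0 < x v) (hw : 0 < x w) : False := by
  have h1 := add_eq_one hx huv hu hv
  have h2 := add_eq_one hx huw hu hw
  have h3 := add_eq_one hx hvw hv hw
  have hu2 : x u = 1 / 2 := by linarith
  have := congrFun (eq_edgeMidpoint hx huv hu2 hv) w
  simp [edgeMidpoint, huw.symm, hvw.symm] at this
  linarith

/-- An open set of functions which cuts out of the realization of a graph the points having more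
than half of their mass on `C`. -/
def heavySet (C : Set V) : Set (V → ℝ) :=
  (⋃ v ∈ C, {x | 1 / 2 < x v}) ∪ ⋃ v ∈ C, ⋃ w ∈ C \ {v}, {x | 0 < x v ∧ 0 < x w}

theorem isOpen_heavySet (C : Set V) : IsOpen (heavySet C) := by
  refine (isOpen_biUnion fun v _ => ?_).union
    (isOpen_biUnion fun v _ => isOpen_biUnion fun w _ => ?_)
  · exact isOpen_lt continuous_const (continuous_apply v)
  · exact (isOpen_lt continuous_const (continuous_apply v)).inter
      (isOpen_lt continuous_const (continuous_apply w))

theorem mem_heavySet {C : Set V} : x ∈ heavySet C ↔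
    (∃ v ∈ C, 1 / 2 < x v) ∨ ∃ v ∈ C, ∃ w ∈ C, w ≠ v ∧ 0 < x v ∧ 0 < x w := by
  simp [heavySet]
  grind

theorem heavySet_disjoint {C : Set V} (hx : x ∈ GraphRealization G) (h1 : x ∈ heavySet C)
    (h2 : x ∈ heavySet Cᶜ) : False := by
  rw [mem_heavySet] at h1 h2
  have key : ∀ {a b}, a ∈ C → b ∈ Cᶜ → a ≠ b := fun ha hb h => hb (h ▸ ha)
  rcases h1 with ⟨v, hv, h1⟩ | ⟨v, hv, w, hw, hne, h1, h1'⟩ <;>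
  rcases h2 with ⟨a, ha, h2⟩ | ⟨a, ha, b, hb, hne', h2, h2'⟩
  · have := GraphRealization.add_eq_one hx (key hv ha) (by linarith) (by linarith)
    linarith
  · exact GraphRealization.not_three_pos hx (key hv ha) (key hv hb) hne'.symm (by linarith) h2 h2'
  · exact GraphRealization.not_three_pos hx hne (key hw ha) (key hv ha) h1' h1 (by linarith)
  · exact GraphRealization.not_three_pos hx hne (key hw ha) (key hv ha) h1' h1 h2

theorem heavySet_cover {C : Set V} (hx : x ∈ GraphRealization G)
    (hC : ∀ v ∈ C, ∀ w ∉ C, G.Adj v w → x ≠ edgeMidpoint s(v, w)) :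
    x ∈ heavySet C ∪ heavySet Cᶜ := by
  simp only [Set.mem_union, mem_heavySet]
  rcases GraphRealization.cases hx with ⟨a, rfl⟩ | ⟨a, b, hab, ha, hb, hsum, h0⟩
  · by_cases h : a ∈ C
    · exact Or.inl (Or.inl ⟨a, h, by norm_num [vertexPoint]⟩)
    · exact Or.inr (Or.inl ⟨a, h, by norm_num [vertexPoint]⟩)
  · have hne := hab.ne
    rcases lt_trichotomy (x a) (1 / 2) with h | h | h
    · by_cases hbC : b ∈ C
      · exact Or.inl (Or.inl ⟨b, hbC, by linarith⟩)
      · exact Or.inr (Or.inl ⟨b, hbC, by linarith⟩)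
    · have hm := GraphRealization.eq_edgeMidpoint hx hne h hb
      by_cases haC : a ∈ C <;> by_cases hbC : b ∈ C
      · exact Or.inl (Or.inr ⟨a, haC, b, hbC, hne.symm, ha, hb⟩)
      · exact absurd hm (hC a haC b hbC hab)
      · exact absurd (hm.trans (by rw [Sym2.eq_swap])) (hC b hbC a haC hab.symm)
      · exact Or.inr (Or.inr ⟨a, haC, b, hbC, hne.symm, ha, hb⟩)
    · by_cases haC : a ∈ C
      · exact Or.inl (Or.inl ⟨a, haC, h⟩)
      · exact Or.inr (Or.inl ⟨a, haC, h⟩)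

end Realization

section Arc

variable {V : Type*} {G : SimpleGraph V} {f : unitInterval → V → ℝ}

/-- A connected set of parameters whose image avoids the midpoint of `vw` and the vertex `v`
cannot leave the open half-edge of `vw` at `v`. -/
theorem mem_halfEdge_of_isPreconnected (hf : Continuous f) (hG : ∀ t, f t ∈ GraphRealization G)
    {v w : V} (hvw : v ≠ w) {S : Set unitInterval} (hS : IsPreconnected S)
    (hm : ∀ t ∈ S, f t ≠ edgeMidpoint s(v, w)) (hv : ∀ t ∈ S, f t ≠ vertexPoint v)
    {s t : unitInterval} (hs : s ∈ S) (ht : t ∈ S) (h1 : 1 / 2 < f s v) (h2 : 0 < f s w) :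
    1 / 2 < f t v := by
  have hc : ∀ u, Continuous fun r => f r u := fun u => (continuous_apply u).comp hf
  set A : Set unitInterval := {r | 1 / 2 < f r v ∧ 0 < f r w}
  set B : Set unitInterval := {r | f r v < 1 / 2} ∪ ⋃ u ∈ ({v, w}ᶜ : Set V), {r | 0 < f r u}
  have hA : IsOpen A :=
    (isOpen_lt continuous_const (hc v)).inter (isOpen_lt continuous_const (hc w))
  have hB : IsOpen B := (isOpen_lt (hc v) continuous_const).union
    (isOpen_biUnion fun u _ => isOpen_lt continuous_const (hc u))
  have hAB : Disjoint A B := by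
    rw [Set.disjoint_left]
    rintro r ⟨ha, hb⟩ (h | h)
    · exact lt_asymm ha h
    · simp only [Set.mem_iUnion, Set.mem_compl_iff, Set.mem_insert_iff, Set.mem_singleton_iff,
        not_or] at h
      obtain ⟨u, ⟨hu, hu'⟩, h⟩ := h
      exact GraphRealization.not_three_pos (hG r) hvw (Ne.symm hu) (Ne.symm hu')
        (by linarith) hb h
  have hcov : S ⊆ A ∪ B := by
    intro r hr
    by_contra hn
    simp only [A, B, Set.mem_union, Set.mem_ofPred_eq, Set.mem_iUnion, Set.mem_compl_iff,
      Set.mem_insert_iff, Set.mem_singleton_iff, not_or, not_exists, not_lt, not_and] at hn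
    obtain ⟨hn1, hn2, hn3⟩ := hn
    rcases GraphRealization.cases (hG r) with ⟨a, ha⟩ | ⟨a, b, hab, ha, hb, hsum, h0⟩
    · by_cases hav : a = v
      · exact hv r hr (hav ▸ ha)
      · have : f r v = 0 := by rw [ha]; simp [vertexPoint, Ne.symm hav]
        linarith
    · have hne := hab.ne
      have hva : v = a ∨ v = b := by
        by_contra! h
        linarith [h0 v h.1 h.2]
      have hpos : 0 < f r w := by
        rcases hva with rfl | rfl
        · by_cases hbw : b = w
          · exact hbw ▸ hb
          · exact absurd hb (not_lt.2 (hn3 b ⟨hne.symm, hbw⟩))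
        · by_cases haw : a = w
          · exact haw ▸ ha
          · exact absurd ha (not_lt.2 (hn3 a ⟨hne, haw⟩))
      have hle : ¬ 1 / 2 < f r v := fun h => absurd hpos (not_lt.2 (hn1 h))
      exact hm r hr (GraphRealization.eq_edgeMidpoint (hG r) hvw
        (le_antisymm (not_lt.1 hle) hn2) hpos)
  exact (hS.subset_left_of_subset_union hA hB hAB hcov ⟨s, hs, h1, h2⟩ ht).1

/-- An arc through the midpoint of an edge crosses it from one half of the edge to the other. -/
theorem exists_crossing (hf : Continuous f) (hinj : Function.Injective f)
    (hG : ∀ t, f t ∈ GraphRealization G) {e : Sym2 V} (he : e ∈ G.edgeSet) {t : unitInterval}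
    (ht : f t = edgeMidpoint e) :
    ∃ p : V × V, s(p.1, p.2) = e ∧ (∀ᶠ r in 𝓝[<] t, 1 / 2 < f r p.1) ∧
      ∀ᶠ r in 𝓝[>] t, 1 / 2 < f r p.2 := by
  induction e with
  | _ v w =>
  rw [SimpleGraph.mem_edgeSet] at he
  have hne := he.ne
  have hc : ∀ u, Continuous fun r => f r u := fun u => (continuous_apply u).comp hf
  have htv : f t v = 1 / 2 := by rw [ht]; simp [edgeMidpoint]
  have htw : f t w = 1 / 2 := by rw [ht]; simp [edgeMidpoint]
  have hN : {r | 0 < f r v ∧ 0 < f r w} ∈ 𝓝 t :=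
    ((isOpen_lt continuous_const (hc v)).inter (isOpen_lt continuous_const (hc w))).mem_nhds
      ⟨show 0 < f t v by rw [htv]; norm_num, show 0 < f t w by rw [htw]; norm_num⟩
  obtain ⟨a, b, htab, hab, hsub⟩ := exists_Icc_mem_subset_of_mem_nhds hN
  have hsum : ∀ r ∈ Set.Icc a b, f r v + f r w = 1 := fun r hr =>
    GraphRealization.add_eq_one (hG r) hne (hsub hr).1 (hsub hr).2
  have hinjOn : Set.InjOn (fun r => f r v) (Set.Icc a b) := by
    intro r hr s hs h
    apply hinj
    have hrs : f r w = f s w := by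
      have := hsum r hr; have := hsum s hs; have : f r v = f s v := h; linarith
    funext u
    by_cases huv : u = v
    · exact huv ▸ h
    by_cases huw : u = w
    · exact huw ▸ hrs
    have h0 : ∀ r ∈ Set.Icc a b, f r u = 0 := by
      intro r hr
      rcases GraphRealization.cases (hG r) with ⟨c, hc⟩ | ⟨c, d, hcd, h1, h2, -, h0⟩
      · have := hsub hr
        simp only [hc, vertexPoint, Set.mem_ofPred_eq] at this ⊢
        split_ifs at this ⊢ <;> simp_all
      · by_contra hn
        have : 0 < f r u := by
          by_cases huc : u = c
          · exact huc ▸ h1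
          by_cases hud : u = d
          · exact hud ▸ h2
          exact absurd (h0 u huc hud) hn
        exact GraphRealization.not_three_pos (hG r) huv huw hne this (hsub hr).1 (hsub hr).2
    rw [h0 r hr, h0 s hs]
  have hev : ∀ᶠ r in 𝓝 t, r ∈ Set.Icc a b := hab
  rcases (hc v).continuousOn.strictMonoOn_of_injOn_Icc' (htab.1.trans htab.2) hinjOn with h | h
  · refine ⟨(w, v), Sym2.eq_swap, ?_, ?_⟩
    · filter_upwards [hev.filter_mono nhdsWithin_le_nhds, self_mem_nhdsWithin] with r hr hrt
      have h1 : f r v < f t v := h hr htab hrt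
      have := hsum r hr
      show 1 / 2 < f r w
      linarith
    · filter_upwards [hev.filter_mono nhdsWithin_le_nhds, self_mem_nhdsWithin] with r hr hrt
      have h1 : f t v < f r v := h htab hr hrt
      show 1 / 2 < f r v
      linarith
  · refine ⟨(v, w), rfl, ?_, ?_⟩
    · filter_upwards [hev.filter_mono nhdsWithin_le_nhds, self_mem_nhdsWithin] with r hr hrt
      have h1 : f t v < f r v := h hr htab hrt
      show 1 / 2 < f r v
      linarith
    · filter_upwards [hev.filter_mono nhdsWithin_le_nhds, self_mem_nhdsWithin] with r hr hrt
      have h1 : f r v < f t v := h htab hr hrt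
      have := hsum r hr
      show 1 / 2 < f r w
      linarith

end Arc

section CrossingSequence

variable {V : Type*} {G : SimpleGraph V} {M : Finset (Sym2 V)} {n : ℕ} {d : Fin (n + 1) → V × V}

/-- `d` lists the edges in `M`, oriented as an arc through all their midpoints traverses them: a cut
contained in `M` is not crossed between consecutive members of `d`, and each vertex is visited
between at most one pair of consecutive members. -/
structure IsCrossingSequence (G : SimpleGraph V) (M : Finset (Sym2 V))
    (d : Fin (n + 1) → V × V) : Prop where
  edge_mem : ∀ i, s((d i).1, (d i).2) ∈ M
  edge_surj : ∀ e ∈ M, ∃ i, s((d i).1, (d i).2) = e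
  edge_inj : Function.Injective fun i => s((d i).1, (d i).2)
  cut : ∀ C : Set V, (∀ x ∈ C, ∀ y ∉ C, G.Adj x y → s(x, y) ∈ M) →
    ∀ i : Fin n, (d i.castSucc).2 ∈ C ↔ (d i.succ).1 ∈ C
  pass : ∀ v, ∀ i j : Fin n, ((d i.castSucc).2 = v ∨ (d i.succ).1 = v) →
    ((d j.castSucc).2 = v ∨ (d j.succ).1 = v) → i = j

theorem exists_isCrossingSequence (hM : ↑M ⊆ G.edgeSet) (hcard : M.card = n + 1)
    {f : unitInterval → V → ℝ} (hf : Continuous f) (hinj : Function.Injective f)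
    (hG : ∀ t, f t ∈ GraphRealization G) (hrange : ∀ e ∈ M, ∃ t, f t = edgeMidpoint e) :
    ∃ d : Fin (n + 1) → V × V, IsCrossingSequence G M d := by
  classical
  have hc : ∀ u, Continuous fun r => f r u := fun u => (continuous_apply u).comp hf
  choose! τ hτ using hrange
  have hτinj : Set.InjOn τ M := fun e he e' he' h =>
    edgeMidpoint_injective (by rw [← hτ e he, ← hτ e' he', h])
  have hT : (M.image τ).card = n + 1 := by rw [Finset.card_image_of_injOn hτinj, hcard]
  set σ := (M.image τ).orderEmbOfFin hT
  have hσ : ∀ i, ∃ e ∈ M, τ e = σ i := fun i =>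
    Finset.mem_image.1 ((M.image τ).orderEmbOfFin_mem hT i)
  have hσ' : ∀ e ∈ M, ∃ i, σ i = τ e := fun e he => by
    have : τ e ∈ Set.range σ := by
      rw [Finset.range_orderEmbOfFin]
      exact Finset.mem_coe.2 (Finset.mem_image_of_mem _ he)
    exact this
  choose ε hεM hε using hσ
  have hfσ : ∀ i, f (σ i) = edgeMidpoint (ε i) := fun i => by rw [← hε, hτ _ (hεM i)]
  choose d hd hleft hright using fun i => exists_crossing hf hinj hG (hM (hεM i)) (hfσ i)
  have hdne : ∀ i, (d i).1 ≠ (d i).2 := fun i => by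
    have := hM (hεM i)
    rw [← hd i, SimpleGraph.mem_edgeSet] at this
    exact this.ne
  have hlt : ∀ i : Fin n, σ i.castSucc < σ i.succ := fun i =>
    σ.strictMono i.castSucc_lt_succ
  have hgap : ∀ (i : Fin n) (j), σ j ∉ Set.Ioo (σ i.castSucc) (σ i.succ) := by
    rintro i j ⟨h1, h2⟩
    rw [OrderEmbedding.lt_iff_lt] at h1 h2
    simp only [Fin.lt_def, Fin.val_castSucc, Fin.val_succ] at h1 h2
    omega
  have hR : ∀ i : Fin n, ∃ r ∈ Set.Ioo (σ i.castSucc) (σ i.succ), 1 / 2 < f r (d i.castSucc).2 ∧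
      0 < f r (d i.castSucc).1 := by
    intro i
    have : (𝓝[>] (σ i.castSucc)).NeBot := nhdsGT_neBot_of_exists_gt ⟨_, hlt i⟩
    have h0 : 0 < f (σ i.castSucc) (d i.castSucc).1 := by
      rw [hfσ, ← hd]; simp [edgeMidpoint]
    have h1 : ∀ᶠ r in 𝓝 (σ i.castSucc), 0 < f r (d i.castSucc).1 :=
      (isOpen_lt continuous_const (hc _)).mem_nhds h0
    obtain ⟨r, hr, hr', hr''⟩ := ((hright i.castSucc).and
      ((h1.filter_mono nhdsWithin_le_nhds).and (Ioo_mem_nhdsGT (hlt i)))).exists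
    exact ⟨r, hr'', hr, hr'⟩
  have hL : ∀ i : Fin n, ∃ r ∈ Set.Ioo (σ i.castSucc) (σ i.succ), 1 / 2 < f r (d i.succ).1 ∧
      0 < f r (d i.succ).2 := by
    intro i
    have : (𝓝[<] (σ i.succ)).NeBot := nhdsLT_neBot_of_exists_lt ⟨_, hlt i⟩
    have h0 : 0 < f (σ i.succ) (d i.succ).2 := by
      rw [hfσ, ← hd]; simp [edgeMidpoint]
    have h1 : ∀ᶠ r in 𝓝 (σ i.succ), 0 < f r (d i.succ).2 :=
      (isOpen_lt continuous_const (hc _)).mem_nhds h0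
    obtain ⟨r, hr, hr', hr''⟩ := ((hleft i.succ).and
      ((h1.filter_mono nhdsWithin_le_nhds).and (Ioo_mem_nhdsLT (hlt i)))).exists
    exact ⟨r, hr'', hr, hr'⟩
  have hmid_ne : ∀ (e : Sym2 V) (v : V), edgeMidpoint e ≠ vertexPoint v := fun e v h => by
    have := edgeMidpoint_le e v
    rw [h] at this
    norm_num [vertexPoint] at this
  have hpass : ∀ v, ∀ i : Fin n, ((d i.castSucc).2 = v ∨ (d i.succ).1 = v) →
      ∃ t ∈ Set.Ioo (σ i.castSucc) (σ i.succ), f t = vertexPoint v := by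
    intro v i h
    by_contra! hn
    rcases h with rfl | rfl
    · obtain ⟨r, hr, h1, h2⟩ := hR i
      have := mem_halfEdge_of_isPreconnected hf hG (hdne _).symm
        (isPreconnected_Ioc (a := σ i.castSucc) (b := σ i.succ))
        (fun t ht h => ht.1.ne' (hinj (h.trans (by rw [hfσ, ← hd, Sym2.eq_swap]))))
        (fun t ht => by
          rcases ht.2.eq_or_lt with h | h
          · rw [h, hfσ]; exact hmid_ne _ _
          · exact hn t ⟨ht.1, h⟩)
        (Set.Ioo_subset_Ioc_self hr) (Set.right_mem_Ioc.2 (hlt i)) h1 h2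
      rw [hfσ] at this
      linarith [edgeMidpoint_le (ε i.succ) (d i.castSucc).2]
    · obtain ⟨r, hr, h1, h2⟩ := hL i
      have := mem_halfEdge_of_isPreconnected hf hG (hdne _)
        (isPreconnected_Ico (a := σ i.castSucc) (b := σ i.succ))
        (fun t ht h => ht.2.ne (hinj (h.trans (by rw [hfσ, ← hd]))))
        (fun t ht => by
          rcases ht.1.eq_or_lt with h | h
          · rw [← h, hfσ]; exact hmid_ne _ _
          · exact hn t ⟨h, ht.2⟩)
        (Set.Ioo_subset_Ico_self hr) (Set.left_mem_Ico.2 (hlt i)) h1 h2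
      rw [hfσ] at this
      linarith [edgeMidpoint_le (ε i.castSucc) (d i.succ).1]
  refine ⟨d, ⟨fun i => by rw [hd]; exact hεM i, fun e he => ?_, fun i j hij => ?_, ?_, ?_⟩⟩
  · obtain ⟨i, hi⟩ := hσ' e he
    exact ⟨i, by rw [hd]; exact hτinj (hεM i) he (by rw [hε, hi])⟩
  · simp only [hd] at hij
    exact σ.injective (by rw [← hε, ← hε, hij])
  · intro C hC i
    have hcov : f '' Set.Ioo (σ i.castSucc) (σ i.succ) ⊆ heavySet C ∪ heavySet Cᶜ := by
      rintro _ ⟨t, ht, rfl⟩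
      refine heavySet_cover (hG t) fun v hv w hw hvw h => ?_
      obtain ⟨j, hj⟩ := hσ' _ (hC v hv w hw hvw)
      have : t = σ j := hinj (by rw [h, hj, hτ _ (hC v hv w hw hvw)])
      exact hgap i j (this ▸ ht)
    have hmem : ∀ {D : Set V} {v t}, v ∈ D → 1 / 2 < f t v → f t ∈ heavySet D :=
      fun hv h => mem_heavySet.2 (Or.inl ⟨_, hv, h⟩)
    have hconst := isPreconnected_iff_subset_of_disjoint.1
      ((isPreconnected_Ioo (a := σ i.castSucc) (b := σ i.succ)).image f hf.continuousOn) _ _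
      (isOpen_heavySet C) (isOpen_heavySet Cᶜ) hcov (by
        rw [Set.eq_empty_iff_forall_notMem]
        rintro _ ⟨⟨t, ht, rfl⟩, h1, h2⟩
        exact heavySet_disjoint (hG t) h1 h2)
    obtain ⟨r, hr, hr1, -⟩ := hR i
    obtain ⟨l, hl, hl1, -⟩ := hL i
    rcases hconst with h | h
    · refine iff_of_true ?_ ?_ <;> by_contra hn
      · exact heavySet_disjoint (hG r) (h ⟨r, hr, rfl⟩) (hmem hn hr1)
      · exact heavySet_disjoint (hG l) (h ⟨l, hl, rfl⟩) (hmem hn hl1)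
    · refine iff_of_false ?_ ?_ <;> intro hn
      · exact heavySet_disjoint (hG r) (hmem hn hr1) (h ⟨r, hr, rfl⟩)
      · exact heavySet_disjoint (hG l) (hmem hn hl1) (h ⟨l, hl, rfl⟩)
  · intro v i j hi hj
    obtain ⟨t, ht, hft⟩ := hpass v i hi
    obtain ⟨t', ht', hft'⟩ := hpass v j hj
    obtain rfl := hinj (hft.trans hft'.symm)
    have h1 : σ i.castSucc < σ j.succ := ht.1.trans ht'.2
    have h2 : σ j.castSucc < σ i.succ := ht'.1.trans ht.2
    rw [OrderEmbedding.lt_iff_lt] at h1 h2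
    simp only [Fin.lt_def, Fin.val_castSucc, Fin.val_succ] at h1 h2
    exact Fin.ext (by omega)

theorem NArcConn.exists_isCrossingSequence {k : ℕ} (hac : NArcConn ↥(GraphRealization G) k)
    (hM : ↑M ⊆ G.edgeSet) (hne : M.Nonempty) (hk : M.card ≤ k) :
    ∃ (n : ℕ) (d : Fin (n + 1) → V × V), IsCrossingSequence G M d := by
  classical
  obtain ⟨A, ⟨φ⟩, hA⟩ := hac
    (M.attach.image fun e : {e // e ∈ M} => ⟨edgeMidpoint e.1, edgeMidpoint_mem (hM e.2)⟩)
    (Finset.card_image_le.trans (by rwa [Finset.card_attach]))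
  obtain ⟨n, hn⟩ := Nat.exists_eq_succ_of_ne_zero hne.card_pos.ne'
  refine ⟨n, _root_.exists_isCrossingSequence (f := fun t => (φ.symm t).1.1) hM hn
    (by fun_prop) (fun s t h => φ.symm.injective (Subtype.ext (Subtype.ext h)))
    (fun t => (φ.symm t).1.2) fun e he => ?_⟩
  have : (⟨edgeMidpoint e, edgeMidpoint_mem (hM he)⟩ : ↥(GraphRealization G)) ∈ A :=
    hA (Finset.mem_coe.2 (Finset.mem_image.2 ⟨⟨e, he⟩, Finset.mem_attach _ _, rfl⟩))
  exact ⟨φ ⟨_, this⟩, by simp⟩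

theorem odd_card_filter_not_iff (a b : Fin (n + 1) → Prop) [DecidablePred a] [DecidablePred b]
    (h : ∀ i : Fin n, b i.castSucc ↔ a i.succ) :
    Odd (Finset.univ.filter fun i => ¬(a i ↔ b i)).card ↔ ¬(a 0 ↔ b (Fin.last n)) := by
  have h1 : ∑ i, ((if a i then 1 else 0) + if b i then 1 else 0) =
      ∑ i, ((if ¬(a i ↔ b i) then 1 else 0) + 2 * if a i ∧ b i then 1 else 0) := by
    refine Finset.sum_congr rfl fun i _ => ?_
    by_cases ha : a i <;> by_cases hb : b i <;> simp [ha, hb]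
  rw [Finset.sum_add_distrib, Fin.sum_univ_succ, Fin.sum_univ_castSucc (n := n)
    (f := fun i => if b i then 1 else 0), Finset.sum_add_distrib, ← Finset.mul_sum] at h1
  simp only [h] at h1
  rw [Nat.odd_iff, Finset.card_filter]
  by_cases ha : a 0 <;> by_cases hb : b (Fin.last n) <;>
    simp only [ha, hb, if_true, if_false, iff_self, not_true, not_false_iff, iff_true,
      iff_false] at h1 ⊢ <;> omega

/-- The edges leaving `C`, oriented outwards. -/
def SimpleGraph.outDarts (G : SimpleGraph V) (C : Set V) : Set (V × V) :=
  {p | p.1 ∈ C ∧ p.2 ∉ C ∧ G.Adj p.1 p.2}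

theorem SimpleGraph.injOn_outDarts (C : Set V) :
    Set.InjOn (fun p : V × V => s(p.1, p.2)) (G.outDarts C) := by
  rintro ⟨a, b⟩ ⟨ha, hb, -⟩ ⟨c, e⟩ ⟨hc, he, -⟩ h
  rcases Sym2.eq_iff.1 h with ⟨rfl, rfl⟩ | ⟨rfl, rfl⟩
  · rfl
  · exact absurd ha he

/-- Parity of the number of crossings of a cut. -/
theorem IsCrossingSequence.odd_ncard_outDarts (h : IsCrossingSequence G M d)
    (hM : ↑M ⊆ G.edgeSet) {C : Set V} (hC : ∀ p ∈ G.outDarts C, s(p.1, p.2) ∈ M) :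
    Odd (G.outDarts C).ncard ↔ ¬((d 0).1 ∈ C ↔ (d (Fin.last n)).2 ∈ C) := by
  classical
  rw [← odd_card_filter_not_iff (fun i => (d i).1 ∈ C) (fun i => (d i).2 ∈ C)
    (h.cut C fun x hx y hy hxy => hC (x, y) ⟨hx, hy, hxy⟩)]
  rw [← (SimpleGraph.injOn_outDarts C).ncard_image, ← Set.ncard_coe_finset,
    ← Set.ncard_image_of_injective _ h.edge_inj]
  suffices hs : (fun p : V × V => s(p.1, p.2)) '' G.outDarts C =
      (fun i => s((d i).1, (d i).2)) ''
        ↑(Finset.univ.filter fun i => ¬((d i).1 ∈ C ↔ (d i).2 ∈ C)) by rw [hs]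
  ext e
  constructor
  · rintro ⟨p, hp, rfl⟩
    obtain ⟨i, hi⟩ := h.edge_surj _ (hC p hp)
    refine ⟨i, ?_, hi⟩
    obtain ⟨h1, h2, -⟩ := hp
    rcases Sym2.eq_iff.1 hi with ⟨h3, h4⟩ | ⟨h3, h4⟩ <;> simp [h3, h4, h1, h2]
  · rintro ⟨i, hi, rfl⟩
    have hadj : G.Adj (d i).1 (d i).2 := hM (h.edge_mem i)
    simp only [Finset.coe_filter, Finset.mem_univ, true_and, Set.mem_ofPred_eq] at hi
    by_cases h1 : (d i).1 ∈ C
    · exact ⟨d i, ⟨h1, by tauto, hadj⟩, rfl⟩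
    · exact ⟨(d i).swap, ⟨by show (d i).2 ∈ C; tauto, h1, hadj.symm⟩, Sym2.eq_swap⟩

/-- The indices of members incident with `v` number at least the listed edges at `v`. -/
theorem IsCrossingSequence.card_le_of_forall_mem (h : IsCrossingSequence G M d) {v : V}
    {N : Finset V} (hN : ∀ y ∈ N, s(v, y) ∈ M) {I : Finset (Fin (n + 1))}
    (hI : ∀ i, ((d i).1 = v ∨ (d i).2 = v) → i ∈ I) : N.card ≤ I.card := by
  choose! g hg using fun y (hy : y ∈ N) => h.edge_surj _ (hN y hy)
  refine Finset.card_le_card_of_injOn g (fun y hy => hI _ ?_) fun y hy z hz hyz => ?_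
  · rcases Sym2.eq_iff.1 (hg y hy) with h | h
    · exact Or.inl h.1
    · exact Or.inr h.2
  · have := (hg y hy).symm.trans (hyz ▸ hg z hz)
    exact Sym2.congr_right.1 this

theorem IsCrossingSequence.exists_card_le_two (h : IsCrossingSequence G M d) (v : V) :
    ∃ I : Finset (Fin (n + 1)), I.card ≤ 2 ∧ ∀ i, ((d i).1 = v ∨ (d i).2 = v) →
      i ∈ I ∨ (i = 0 ∧ (d i).1 = v) ∨ (i = Fin.last n ∧ (d i).2 = v) := by
  classical
  by_cases hex : ∃ j : Fin n, (d j.castSucc).2 = v ∨ (d j.succ).1 = v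
  · obtain ⟨j, hj⟩ := hex
    refine ⟨{j.castSucc, j.succ}, Finset.card_le_two, ?_⟩
    rintro i (hi | hi)
    · rcases Fin.eq_zero_or_eq_succ i with rfl | ⟨k, rfl⟩
      · exact Or.inr (Or.inl ⟨rfl, hi⟩)
      · left; rw [h.pass v k j (Or.inr hi) hj]; simp
    · rcases Fin.eq_castSucc_or_eq_last i with ⟨k, rfl⟩ | rfl
      · left; rw [h.pass v k j (Or.inl hi) hj]; simp
      · exact Or.inr (Or.inr ⟨rfl, hi⟩)
  · push Not at hex
    refine ⟨∅, by simp, ?_⟩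
    rintro i (hi | hi)
    · rcases Fin.eq_zero_or_eq_succ i with rfl | ⟨k, rfl⟩
      · exact Or.inr (Or.inl ⟨rfl, hi⟩)
      · exact absurd hi (hex k).2
    · rcases Fin.eq_castSucc_or_eq_last i with ⟨k, rfl⟩ | rfl
      · exact absurd hi (hex k).1
      · exact Or.inr (Or.inr ⟨rfl, hi⟩)

theorem IsCrossingSequence.eq_or_eq_of_three_le (h : IsCrossingSequence G M d) {v : V}
    {N : Finset V} (hN : ∀ y ∈ N, s(v, y) ∈ M) (h3 : 3 ≤ N.card) :
    (d 0).1 = v ∨ (d (Fin.last n)).2 = v := by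
  obtain ⟨I, hI, hmem⟩ := h.exists_card_le_two v
  by_contra! hn
  have := h.card_le_of_forall_mem hN (I := I) fun i hi => by
    rcases hmem i hi with h | ⟨rfl, h⟩ | ⟨rfl, h⟩
    exacts [h, absurd h hn.1, absurd h hn.2]
  omega

theorem IsCrossingSequence.eq_and_eq_of_four_le (h : IsCrossingSequence G M d) {v : V}
    {N : Finset V} (hN : ∀ y ∈ N, s(v, y) ∈ M) (h4 : 4 ≤ N.card) :
    (d 0).1 = v ∧ (d (Fin.last n)).2 = v := by
  obtain ⟨I, hI, hmem⟩ := h.exists_card_le_two v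
  constructor <;> by_contra hn
  · have := h.card_le_of_forall_mem hN (I := insert (Fin.last n) I) fun i hi => by
      rcases hmem i hi with h | ⟨rfl, h⟩ | ⟨rfl, h⟩
      exacts [Finset.mem_insert_of_mem h, absurd h hn, Finset.mem_insert_self _ _]
    have := Finset.card_insert_le (Fin.last n) I
    omega
  · have := h.card_le_of_forall_mem hN (I := insert 0 I) fun i hi => by
      rcases hmem i hi with h | ⟨rfl, h⟩ | ⟨rfl, h⟩
      exacts [Finset.mem_insert_of_mem h, Finset.mem_insert_self _ _, absurd h hn]
    have := Finset.card_insert_le 0 I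
    omega

end CrossingSequence

section SixArcConnected

variable {V : Type*} {G : SimpleGraph V}

theorem SimpleGraph.exists_card_eq_three (hdeg : ∀ v, 3 ≤ (G.neighborSet v).encard) (v : V) :
    ∃ N : Finset V, N.card = 3 ∧ ∀ y ∈ N, G.Adj v y := by
  obtain ⟨t, ht, hc⟩ := Set.exists_subset_encard_eq (hdeg v)
  have hfin : t.Finite := Set.finite_of_encard_eq_coe hc
  refine ⟨hfin.toFinset, ?_, fun y hy => ht (hfin.mem_toFinset.1 hy)⟩
  rw [hfin.encard_eq_coe_toFinset_card] at hc
  exact_mod_cast hc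

theorem NArcConn.encard_neighborSet_eq_three (hdeg : ∀ v, 3 ≤ (G.neighborSet v).encard)
    (hac : NArcConn ↥(GraphRealization G) 6) (v : V) : (G.neighborSet v).encard = 3 := by
  classical
  by_contra hne
  have h4 : 4 ≤ (G.neighborSet v).encard := by
    have := Order.add_one_le_of_lt (lt_of_le_of_ne (hdeg v) (Ne.symm hne))
    exact this
  obtain ⟨t, ht, hc⟩ := Set.exists_subset_encard_eq h4
  have hfin : t.Finite := Set.finite_of_encard_eq_coe hc
  obtain ⟨N, rfl⟩ := hfin.exists_finset_coe
  rw [Set.encard_coe_eq_coe_finsetCard] at hc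
  have hN : N.card = 4 := by exact_mod_cast hc
  obtain ⟨w, hw⟩ : N.Nonempty := Finset.card_pos.1 (by omega)
  have hvw : G.Adj v w := ht hw
  obtain ⟨t', ht', hc'⟩ : ∃ t ⊆ G.neighborSet w \ {v}, t.encard = 2 := by
    refine Set.exists_subset_encard_eq ?_
    have := hdeg w
    rw [← Set.encard_sdiff_singleton_add_one (show v ∈ G.neighborSet w from hvw.symm)] at this
    exact (ENat.add_le_add_iff_right ENat.one_ne_top).1 this
  have hfin' : t'.Finite := Set.finite_of_encard_eq_coe hc'
  obtain ⟨N', rfl⟩ := hfin'.exists_finset_coe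
  rw [Set.encard_coe_eq_coe_finsetCard] at hc'
  have hN' : N'.card = 2 := by exact_mod_cast hc'
  set M : Finset (Sym2 V) := N.image (fun y => s(v, y)) ∪ N'.image (fun y => s(w, y))
  have hvM : ∀ y ∈ N, s(v, y) ∈ M := fun y hy =>
    Finset.mem_union_left _ (Finset.mem_image_of_mem _ hy)
  have hwM : ∀ y ∈ insert v N', s(w, y) ∈ M := fun y hy => by
    rcases Finset.mem_insert.1 hy with rfl | hy
    · rw [Sym2.eq_swap]; exact hvM w hw
    · exact Finset.mem_union_right _ (Finset.mem_image_of_mem _ hy)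
  have hM : ↑M ⊆ G.edgeSet := by
    intro e he
    rcases Finset.mem_union.1 (Finset.mem_coe.1 he) with he | he <;>
      obtain ⟨y, hy, rfl⟩ := Finset.mem_image.1 he
    · exact ht hy
    · exact (ht' hy).1
  have hcard : M.card ≤ 6 := by
    refine (Finset.card_union_le _ _).trans ?_
    have h2 := Finset.card_image_le (s := N) (f := fun y => s(v, y))
    have h3 := Finset.card_image_le (s := N') (f := fun y => s(w, y))
    omega
  obtain ⟨n, d, hd⟩ := hac.exists_isCrossingSequence hM ⟨_, hvM w hw⟩ hcard
  have hends := hd.eq_and_eq_of_four_le hvM hN.ge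
  have hvN' : v ∉ N' := fun h => (ht' h).2 rfl
  have := hd.eq_or_eq_of_three_le hwM (by rw [Finset.card_insert_of_notMem hvN']; omega)
  rw [hends.1, hends.2, or_self] at this
  exact hvw.ne this

/-- If the cut at `C` and the edges at `u` and `w` number at most six, then some arc through all
their midpoints runs from `u` to `w`, so that its ends determine the parity of the cut. -/
theorem NArcConn.odd_ncard_outDarts_iff (hdeg : ∀ v, (G.neighborSet v).encard = 3)
    (hac : NArcConn ↥(GraphRealization G) 6) {C : Set V} {u w : V} (huw : u ≠ w)
    (D : Finset (Sym2 V)) (hDG : ↑D ⊆ G.edgeSet)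
    (hD : ∀ p ∈ G.outDarts C, s(p.1, p.2) ∈ D ∨ u ∈ s(p.1, p.2) ∨ w ∈ s(p.1, p.2))
    (hcard : D = ∅ ∨ G.Adj u w ∧ D.card ≤ 1) :
    Odd (G.outDarts C).ncard ↔ ¬(u ∈ C ↔ w ∈ C) := by
  classical
  obtain ⟨N, hN, hNu⟩ := SimpleGraph.exists_card_eq_three (fun v => (hdeg v).ge) u
  obtain ⟨N', hN', hNw⟩ := SimpleGraph.exists_card_eq_three (fun v => (hdeg v).ge) w
  have hall : ∀ {v : V} {N : Finset V}, N.card = 3 → (∀ y ∈ N, G.Adj v y) →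
      ∀ y, G.Adj v y → y ∈ N := by
    intro v N hN hNv y hy
    have hsub : (N : Set V) ⊆ G.neighborSet v := fun y hy => hNv y hy
    have heq := N.finite_toSet.eq_of_subset_of_encard_le hsub (by
      rw [hdeg, Set.encard_coe_eq_coe_finsetCard, hN]; rfl)
    exact Finset.mem_coe.1 (heq ▸ hy)
  set A := N.image (fun y => s(u, y))
  set B := N'.image (fun y => s(w, y))
  set M : Finset (Sym2 V) := A ∪ B ∪ D
  have huM : ∀ y ∈ N, s(u, y) ∈ M := fun y hy =>
    Finset.mem_union_left _ (Finset.mem_union_left _ (Finset.mem_image_of_mem _ hy))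
  have hwM : ∀ y ∈ N', s(w, y) ∈ M := fun y hy =>
    Finset.mem_union_left _ (Finset.mem_union_right _ (Finset.mem_image_of_mem _ hy))
  have hM : ↑M ⊆ G.edgeSet := by
    intro e he
    rcases Finset.mem_union.1 (Finset.mem_coe.1 he) with he | he
    · rcases Finset.mem_union.1 he with he | he <;> obtain ⟨y, hy, rfl⟩ := Finset.mem_image.1 he
      · exact hNu y hy
      · exact hNw y hy
    · exact hDG he
  have hMcard : M.card ≤ 6 := by
    have h1 := Finset.card_union_le (A ∪ B) D
    have h2 := Finset.card_union_add_card_inter A B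
    have h3 : A.card ≤ 3 := hN ▸ Finset.card_image_le
    have h4 : B.card ≤ 3 := hN' ▸ Finset.card_image_le
    refine h1.trans ?_
    rcases hcard with rfl | ⟨h, hD1⟩
    · rw [Finset.card_empty]
      omega
    · have : 0 < (A ∩ B).card := Finset.card_pos.2 ⟨s(u, w), Finset.mem_inter.2
        ⟨Finset.mem_image_of_mem _ (hall hN hNu w h),
          Finset.mem_image.2 ⟨u, hall hN' hNw u h.symm, Sym2.eq_swap⟩⟩⟩
      omega
  have hne : M.Nonempty := by
    obtain ⟨y, hy⟩ : N.Nonempty := Finset.card_pos.1 (by omega)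
    exact ⟨_, huM y hy⟩
  have hmem : ∀ {p q : V}, G.Adj p q → (u ∈ s(p, q) → s(p, q) ∈ M) ∧
      (w ∈ s(p, q) → s(p, q) ∈ M) := by
    intro p q hpq
    constructor <;> intro h <;> rcases Sym2.mem_iff.1 h with rfl | rfl
    · exact huM q (hall hN hNu q hpq)
    · rw [Sym2.eq_swap]; exact huM p (hall hN hNu p hpq.symm)
    · exact hwM q (hall hN' hNw q hpq)
    · rw [Sym2.eq_swap]; exact hwM p (hall hN' hNw p hpq.symm)
  obtain ⟨n, d, hd⟩ := hac.exists_isCrossingSequence hM hne hMcard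
  rw [hd.odd_ncard_outDarts hM fun p hp => by
    rcases hD p hp with h | h | h
    exacts [Finset.mem_union_right _ h, (hmem hp.2.2).1 h, (hmem hp.2.2).2 h]]
  have h1 := hd.eq_or_eq_of_three_le huM hN.ge
  have h2 := hd.eq_or_eq_of_three_le hwM hN'.ge
  rcases h1 with h1 | h1 <;> rcases h2 with h2 | h2
  · exact absurd (h1.symm.trans h2) huw
  · rw [h1, h2]
  · rw [h1, h2, iff_comm (a := w ∈ C)]
  · exact absurd (h1.symm.trans h2) huw

theorem NArcConn.two_lt_encard_outDarts (hdeg : ∀ v, (G.neighborSet v).encard = 3)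
    (hac : NArcConn ↥(GraphRealization G) 6) {C : Set V} (hC : C.Nonempty) (hC' : Cᶜ.Nonempty) :
    2 < (G.outDarts C).encard := by
  classical
  by_contra! hle
  obtain ⟨u, hu⟩ := hC
  obtain ⟨w, hw⟩ := hC'
  have hfin : (G.outDarts C).Finite := Set.finite_of_encard_le_coe hle
  have hle' : (G.outDarts C).ncard ≤ 2 := by
    rw [← hfin.cast_ncard_eq] at hle
    exact_mod_cast hle
  rcases Nat.le_iff_lt_or_eq.1 hle' with hlt | h2
  · rcases Nat.le_iff_lt_or_eq.1 (Nat.lt_succ_iff.1 hlt) with h0 | h1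
    · have hemp : G.outDarts C = ∅ := (Set.ncard_eq_zero hfin).1 (by omega)
      have := hac.odd_ncard_outDarts_iff hdeg (C := C) (fun h => hw (h ▸ hu) : u ≠ w) ∅ (by simp)
        (by simp [hemp]) (Or.inl rfl)
      rw [hemp] at this
      simp only [Set.ncard_empty, Nat.not_odd_zero, false_iff, not_not] at this
      exact hw (this.1 hu)
    · obtain ⟨p, hp⟩ := Set.ncard_eq_one.1 h1
      have hpm : p ∈ G.outDarts C := hp ▸ rfl
      obtain ⟨x, hx, hxne⟩ : ∃ x, G.Adj p.1 x ∧ x ≠ p.2 := by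
        obtain ⟨x, hx, hxne⟩ := Set.exists_ne_of_one_lt_encard
          (s := G.neighborSet p.1) (by rw [hdeg]; norm_num) p.2
        exact ⟨x, hx, hxne⟩
      have hxC : x ∈ C := by
        by_contra hxC
        have : (p.1, x) ∈ G.outDarts C := ⟨hpm.1, hxC, hx⟩
        rw [hp, Set.mem_singleton_iff] at this
        exact hxne (congrArg Prod.snd this)
      have := hac.odd_ncard_outDarts_iff hdeg (C := C) hx.ne ∅ (by simp)
        (by rw [hp]; rintro _ rfl; simp) (Or.inl rfl)
      rw [h1] at this
      exact this.1 odd_one (iff_of_true hpm.1 hxC)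
  · obtain ⟨p, q, hpq, hC2⟩ := Set.ncard_eq_two.1 h2
    have hpm : p ∈ G.outDarts C := by rw [hC2]; simp
    have hqm : q ∈ G.outDarts C := by rw [hC2]; simp
    have := hac.odd_ncard_outDarts_iff hdeg (C := C) hpm.2.2.ne {s(q.1, q.2)}
      (by simpa using hqm.2.2) (by
        rw [hC2]
        rintro _ (rfl | rfl) <;> simp) (Or.inr ⟨hpm.2.2, by simp⟩)
    rw [h2] at this
    have h := not_not.1 (this.not.1 (by decide))
    exact hpm.2.1 (h.1 hpm.1)

/-- In a cubic graph, a disconnecting vertex set yields an edge cut that is no larger. -/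
theorem SimpleGraph.exists_encard_outDarts_le (hdeg : ∀ v, (G.neighborSet v).encard = 3)
    {S A : Set V} (hA : ∀ x ∈ A, ∀ y ∉ A, G.Adj x y → y ∈ S) :
    ∃ C, A ⊆ C ∧ C ⊆ A ∪ S ∧ (G.outDarts C).encard ≤ S.encard := by
  classical
  let B : Set V := (A ∪ S)ᶜ
  let P : Set V := {s | (G.neighborSet s ∩ B).Subsingleton}
  have hP : ∀ s ∉ P, (G.neighborSet s \ B).Subsingleton := by
    intro s hs
    have h1 : 1 < (G.neighborSet s ∩ B).encard :=
      Set.one_lt_encard_iff_nontrivial.2 (Set.not_subsingleton_iff.1 hs)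
    have h2 := Set.encard_sdiff_add_encard_inter (G.neighborSet s) B
    rw [hdeg] at h2
    refine Set.encard_le_one_iff_subsingleton.1 ?_
    have h3 : (2 : ℕ∞) ≤ (G.neighborSet s ∩ B).encard := Order.add_one_le_of_lt h1
    have h4 : (G.neighborSet s \ B).encard + 2 ≤ 1 + 2 := by
      calc _ ≤ (G.neighborSet s \ B).encard + (G.neighborSet s ∩ B).encard := by gcongr
        _ = 3 := h2
        _ = 1 + 2 := by norm_num
    exact (ENat.add_le_add_iff_right (by norm_num)).1 h4
  refine ⟨A ∪ (S ∩ P), Set.subset_union_left,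
    Set.union_subset_union_right _ Set.inter_subset_left, ?_⟩
  let g : V × V → V := fun p => if p.2 ∈ S then p.2 else p.1
  have key : ∀ p ∈ G.outDarts (A ∪ (S ∩ P)), (p.2 ∈ S ∧ p.2 ∉ P ∧ p.1 ∉ B) ∨
      (p.2 ∉ S ∧ p.1 ∈ S ∧ p.1 ∈ P ∧ p.2 ∈ B) := by
    rintro ⟨a, b⟩ ⟨ha, hb, hab⟩
    simp only [Set.mem_union, Set.mem_inter_iff, not_or, not_and] at ha hb
    by_cases hbS : b ∈ S
    · refine Or.inl ⟨hbS, hb.2 hbS, fun h => h ?_⟩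
      exact ha.imp_right And.left
    · right
      rcases ha with ha | ha
      · exact absurd (hA a ha b hb.1 hab) hbS
      · exact ⟨hbS, ha.1, ha.2, fun h => h.elim hb.1 hbS⟩
  refine Set.encard_le_encard_of_injOn (f := g) ?_ ?_
  · intro p hp
    rcases key p hp with h | h
    · simp [g, h.1]
    · simpa [g, h.1] using h.2.1
  · rintro ⟨a, b⟩ hp ⟨a', b'⟩ hq h
    have hp' := key _ hp
    have hq' := key _ hq
    have h1 := hp.2.2
    have h2 := hq.2.2
    rcases hp' with hp' | hp' <;> rcases hq' with hq' | hq' <;>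
      simp only [g, hp'.1, hq'.1, if_true, if_false] at h hp' hq' h1 h2 <;> subst h
    · rw [hP b hp'.2.1 ⟨h1.symm, hp'.2.2⟩ ⟨h2.symm, hq'.2.2⟩]
    · exact absurd hq'.2.2.1 hp'.2.1
    · exact absurd hp'.2.2.1 hq'.2.1
    · have : b = b' := hp'.2.2.1 ⟨h1, hp'.2.2.2⟩ ⟨h2, hq'.2.2.2⟩
      rw [this]

theorem NArcConn.kConnected_three (hdeg : ∀ v, (G.neighborSet v).encard = 3)
    (hac : NArcConn ↥(GraphRealization G) 6) : KConnected G 3 := by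
  intro S hS
  have hS2 : S.encard ≤ 2 := Order.le_of_lt_add_one hS
  have hV : Nonempty V := by
    obtain ⟨A, ⟨φ⟩, -⟩ := hac ∅ (by simp)
    rcases GraphRealization.cases (φ.symm 0).1.2 with ⟨v, -⟩ | ⟨v, -⟩ <;> exact ⟨v⟩
  have hne : Nonempty ↥Sᶜ := by
    by_contra hemp
    rw [Set.nonempty_coe_sort, Set.not_nonempty_iff_eq_empty, Set.compl_empty_iff] at hemp
    obtain ⟨v⟩ := hV
    have h3 := Set.encard_le_encard (s := G.neighborSet v) (t := S) (by simp [hemp])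
    rw [hdeg] at h3
    exact absurd (h3.trans hS2) (by norm_num)
  refine ⟨fun a b => ?_⟩
  by_contra hab
  let A : Set V := {x | ∃ h : x ∈ Sᶜ, (G.induce Sᶜ).Reachable a ⟨x, h⟩}
  obtain ⟨C, hAC, hCA, hle⟩ := SimpleGraph.exists_encard_outDarts_le (A := A) hdeg (by
      rintro x ⟨hxS, hx⟩ y hy hxy
      by_contra hyS
      exact hy ⟨hyS, hx.trans (SimpleGraph.Adj.reachable (G := G.induce Sᶜ)
        (u := ⟨x, hxS⟩) (v := ⟨y, hyS⟩) hxy)⟩)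
  refine absurd (hac.two_lt_encard_outDarts hdeg ⟨a, hAC ⟨a.2, .rfl⟩⟩ ⟨b, fun hb => ?_⟩)
    (not_lt.2 (hle.trans hS2))
  rcases hCA hb with ⟨_, h⟩ | h
  · exact hab h
  · exact b.2 h

theorem NArcConn.not_exists_four_components (hdeg : ∀ v, (G.neighborSet v).encard = 3)
    (hac : NArcConn ↥(GraphRealization G) 6) {F : Set (Sym2 V)} (hF : F ⊆ G.edgeSet)
    (hF6 : F.encard = 6) (f : Fin 4 → (G.deleteEdges F).ConnectedComponent)
    (hf : Function.Injective f) : False := by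
  classical
  obtain ⟨M, rfl⟩ := (Set.finite_of_encard_eq_coe hF6).exists_finset_coe
  have hM6 : M.card = 6 := by
    rw [Set.encard_coe_eq_coe_finsetCard] at hF6
    exact_mod_cast hF6
  let K : Fin 4 → Set V := fun i => (f i).supp
  have hKF : ∀ i, ∀ p ∈ G.outDarts (K i), s(p.1, p.2) ∈ M := by
    rintro i ⟨a, b⟩ ⟨ha, hb, hab⟩
    by_contra hn
    have hadj : (G.deleteEdges ↑M).Adj a b := by
      rw [SimpleGraph.deleteEdges_adj]; exact ⟨hab, hn⟩
    have ha' : (G.deleteEdges ↑M).connectedComponentMk a = f i := ha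
    exact hb ((SimpleGraph.ConnectedComponent.eq.2 hadj.reachable).symm.trans ha')
  have hKne : ∀ i, (K i).Nonempty := fun i => (f i).nonempty_supp
  have hKdis : ∀ i j, i ≠ j → Disjoint (K i) (K j) := fun i j hij =>
    SimpleGraph.pairwise_disjoint_supp_connectedComponent _ (hf.ne hij)
  have hlt : ∀ i, 2 < (G.outDarts (K i)).encard := by
    intro i
    obtain ⟨j, hj⟩ := exists_ne i
    obtain ⟨x, hx⟩ := hKne j
    exact hac.two_lt_encard_outDarts hdeg (hKne i)
      ⟨x, fun h => Set.disjoint_left.1 (hKdis j i hj) hx h⟩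
  have hfin : ∀ i, (G.outDarts (K i)).Finite := fun i =>
    Set.Finite.of_finite_image (M.finite_toSet.subset (by
      rintro _ ⟨p, hp, rfl⟩; exact hKF i p hp)) (SimpleGraph.injOn_outDarts (K i))
  let D : Fin 4 → Finset (V × V) := fun i => (hfin i).toFinset
  have hD3 : ∀ i, 3 ≤ (D i).card := by
    intro i
    have := hlt i
    rw [(hfin i).encard_eq_coe_toFinset_card] at this
    exact Nat.succ_le_of_lt (by exact_mod_cast this)
  have hsum : ∑ i, (D i).card ≤ 2 * M.card := by
    rw [← Finset.card_biUnion fun i _ j _ hij => by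
      refine Finset.disjoint_left.2 fun p hp hq => ?_
      exact Set.disjoint_left.1 (hKdis i j hij) ((hfin i).mem_toFinset.1 hp).1
        ((hfin j).mem_toFinset.1 hq).1]
    refine Finset.card_le_mul_card_image_of_maps_to (f := fun p : V × V => s(p.1, p.2)) ?_ 2 ?_
    · intro p hp
      obtain ⟨i, -, hi⟩ := Finset.mem_biUnion.1 hp
      exact hKF i p ((hfin i).mem_toFinset.1 hi)
    · intro e _
      induction e with
      | _ a b =>
        refine (Finset.card_le_card (t := {(a, b), (b, a)}) ?_).trans Finset.card_le_two
        rintro ⟨c, d⟩ hp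
        have := (Finset.mem_filter.1 hp).2
        simpa [Sym2.eq_iff] using this
  have hodd : ∀ i, Odd (G.outDarts (K i)).ncard := by
    intro i
    rw [Set.ncard_eq_toFinset_card _ (hfin i)]
    have h3 : (D i).card = 3 := by
      rw [Fin.sum_univ_four] at hsum
      have h0 := hD3 0
      have h1 := hD3 1
      have h2 := hD3 2
      have h3 := hD3 3
      fin_cases i <;> simp only [Fin.zero_eta, Fin.mk_one, Fin.reduceFinMk] <;> omega
    exact h3 ▸ by decide
  obtain ⟨n, d, hd⟩ := hac.exists_isCrossingSequence hF (Finset.card_pos.1 (by omega)) hM6.le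
  have hends : ∀ i, f i = (G.deleteEdges ↑M).connectedComponentMk (d 0).1 ∨
      f i = (G.deleteEdges ↑M).connectedComponentMk (d (Fin.last n)).2 := by
    intro i
    have := (hd.odd_ncard_outDarts hF (hKF i)).1 (hodd i)
    by_contra! hn
    exact this (iff_of_false (fun h => hn.1 (Eq.symm h)) fun h => hn.2 (Eq.symm h))
  have h01 : f 0 ≠ f 1 := hf.ne (by decide)
  have h02 : f 0 ≠ f 2 := hf.ne (by decide)
  have h12 : f 1 ≠ f 2 := hf.ne (by decide)
  rcases hends 0 with h0 | h0 <;> rcases hends 1 with h1 | h1 <;> rcases hends 2 with h2 | h2 <;>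
    simp_all

end SixArcConnected

/-- If every vertex of `G` has degree at least 3 and `|G|` is 6-arc
connected, then `G` is 3-regular, 3-connected, and no set of 6 edges disconnects `G`
into 4 or more components. -/
theorem statement13 {V : Type*} (G : SimpleGraph V)
    (hdeg : ∀ v : V, 3 ≤ (G.neighborSet v).encard)
    (hac : NArcConn ↥(GraphRealization G) 6) :
    (∀ v : V, (G.neighborSet v).encard = 3) ∧
    KConnected G 3 ∧
    ¬ ∃ F : Set (Sym2 V), F ⊆ G.edgeSet ∧ F.encard = 6 ∧
        ∃ f : Fin 4 → (G.deleteEdges F).ConnectedComponent, Function.Injective f := by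
  have hreg := hac.encard_neighborSet_eq_three hdeg
  exact ⟨hreg, hac.kConnected_three hreg, fun ⟨F, hF, hF6, f, hf⟩ =>
    hac.not_exists_four_components hreg hF hF6 f hf⟩
end

section
/- Let G be a simple graph that is 3-regular and 3-connected. Then any four points of |G| lie on a subspace of |G| homeomorphic to a circle or to a θ-curve. -/
open Topology

namespace CubicTheta

open SimpleGraph SimpleGraph.Walk

section Paths

variable {V : Type*} {G : SimpleGraph V}

theorem isPath_append_iff {u v w : V} {P : G.Walk u v} {Q : G.Walk v w} :
    (P.append Q).IsPath ↔ P.IsPath ∧ Q.IsPath ∧ ∀ x ∈ P.support, x ∈ Q.support → x = v := by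
  induction P with
  | nil =>
    simp only [nil_append, support_nil, List.mem_singleton]
    exact ⟨fun h => ⟨IsPath.nil, h, fun _ hx _ => hx⟩, fun h => h.2.1⟩
  | @cons a b c h P ih =>
    simp only [cons_append, cons_isPath_iff, ih, mem_support_append_iff, support_cons,
      List.mem_cons]
    constructor
    · rintro ⟨⟨h1, h2, h3⟩, h4⟩
      refine ⟨⟨h1, fun h => h4 (Or.inl h)⟩, h2, ?_⟩
      rintro x (rfl | hx) hxQ
      · exact absurd (Or.inr hxQ) h4
      · exact h3 x hx hxQ
    · rintro ⟨⟨h1, h2⟩, h3, h4⟩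
      refine ⟨⟨h1, h3, fun x hx => h4 x (Or.inr hx)⟩, ?_⟩
      rintro (hx | hx)
      · exact h2 hx
      · have := h4 a (Or.inl rfl) hx
        subst this
        exact h2 P.end_mem_support

/-- A path which contains the edge joining its ends has no further vertex. -/
theorem IsPath.eq_or_eq_of_mem_edges {u v x : V} {P : G.Walk u v} (hP : P.IsPath)
    (h : s(u, v) ∈ P.edges) (hx : x ∈ P.support) : x = u ∨ x = v := by
  rw [hP.eq_adj_toWalk_of_mem_edges h] at hx
  simpa using hx

/-- A path which contains the edge joining its ends has no further edge. -/
theorem IsPath.edge_eq_of_mem_edges {u v : V} {P : G.Walk u v} (hP : P.IsPath)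
    (h : s(u, v) ∈ P.edges) {e : Sym2 V} (he : e ∈ P.edges) : e = s(u, v) := by
  rw [hP.eq_adj_toWalk_of_mem_edges h] at he
  simpa using he

/-- A path through a given edge splits at that edge. -/
theorem exists_append_cons_of_mem_edges {u v : V} (P : G.Walk u v) {e : Sym2 V}
    (he : e ∈ P.edges) : ∃ (x y : V) (h : G.Adj x y) (P₁ : G.Walk u x) (P₂ : G.Walk y v),
      e = s(x, y) ∧ P = P₁.append (cons h P₂) := by
  induction P with
  | nil => simp at he
  | @cons a b c h P ih =>
    rw [edges_cons, List.mem_cons] at he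
    rcases he with rfl | he
    · exact ⟨a, b, h, nil, P, rfl, rfl⟩
    · obtain ⟨x, y, h', P₁, P₂, rfl, rfl⟩ := ih he
      exact ⟨x, y, h', cons h P₁, P₂, rfl, rfl⟩

/-- Two vertices split a path into three segments. -/
theorem exists_append_append_of_mem {a b u w : V} (P : G.Walk a b) (hu : u ∈ P.support)
    (hw : w ∈ P.support) :
    (∃ (P₁ : G.Walk a u) (P₂ : G.Walk u w) (P₃ : G.Walk w b), P = P₁.append (P₂.append P₃)) ∨
    ∃ (P₁ : G.Walk a w) (P₂ : G.Walk w u) (P₃ : G.Walk u b), P = P₁.append (P₂.append P₃) := by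
  obtain ⟨X, Y, rfl⟩ := mem_support_iff_exists_append.1 hu
  rcases (mem_support_append_iff _ _).1 hw with hw | hw
  · obtain ⟨X₁, X₂, rfl⟩ := mem_support_iff_exists_append.1 hw
    exact Or.inr ⟨X₁, X₂, Y, by rw [append_assoc]⟩
  · obtain ⟨Y₁, Y₂, rfl⟩ := mem_support_iff_exists_append.1 hw
    exact Or.inl ⟨X, Y₁, Y₂, rfl⟩

/-- A walk meeting a set has a final segment meeting it in its first vertex only. -/
theorem exists_suffix_of_mem {a b : V} (W : G.Walk a b) (S : Set V) :
    (∀ v ∈ W.support, v ∉ S) ∨ ∃ (x : V) (W' : G.Walk x b), x ∈ S ∧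
      (∀ v ∈ W'.support, v ∈ S → v = x) ∧ W'.support ⊆ W.support := by
  induction W with
  | @nil u =>
    by_cases h : u ∈ S
    · exact Or.inr ⟨u, nil, h, by simp, by simp⟩
    · left; simpa using h
  | @cons u v w h W ih =>
    rcases ih with ih | ⟨x, W', h1, h2, h3⟩
    · by_cases hu : u ∈ S
      · refine Or.inr ⟨u, cons h W, hu, ?_, by simp⟩
        simp only [support_cons, List.mem_cons]
        rintro z (rfl | hz) hzS
        · rfl
        · exact absurd hzS (ih z hz)
      · left
        simpa [hu] using ih
    · exact Or.inr ⟨x, W', h1, h2, fun z hz => by simp [h3 hz]⟩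

/-- A walk between two sets contains a path between them meeting them in its ends only. -/
theorem exists_isPath_between {A B : Set V} {a b : V} (ha : a ∈ A) (hb : b ∈ B)
    (W : G.Walk a b) : ∃ (x y : V) (P : G.Walk x y), x ∈ A ∧ y ∈ B ∧ P.IsPath ∧
      P.support ⊆ W.support ∧ (∀ v ∈ P.support, v ∈ A → v = x) ∧
      ∀ v ∈ P.support, v ∈ B → v = y := by
  classical
  obtain h | ⟨x, W₁, hx, h1, h2⟩ := exists_suffix_of_mem W A
  · exact absurd ha (h a W.start_mem_support)
  obtain h | ⟨y, W₂, hy, h3, h4⟩ := exists_suffix_of_mem W₁.reverse B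
  · exact absurd hb (h b (by simp))
  have h5 : ∀ v ∈ W₂.reverse.bypass.support, v ∈ W₂.support := fun v hv => by
    simpa using support_bypass_subset_support _ hv
  have h6 : ∀ v ∈ W₂.support, v ∈ W₁.support := fun v hv => by simpa using h4 hv
  exact ⟨x, y, W₂.reverse.bypass, hx, hy, bypass_isPath _, fun v hv => h2 (h6 v (h5 v hv)),
    fun v hv => h1 v (h6 v (h5 v hv)), fun v hv => h3 v (h5 v hv)⟩

/-- If no single vertex separates `A` from `B`, then each vertex which can be reached from `A`
is the end of a walk from `A` that is disjoint from some walk from `A` to `B`. -/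
theorem exists_disjoint_walks_aux {A B : Set V}
    (hsep : ∀ s, ∃ a ∈ A, ∃ b ∈ B, ∃ W : G.Walk a b, s ∉ W.support) {a v : V} (ha : a ∈ A)
    (W : G.Walk v a) : ∃ a₁ ∈ A, ∃ a₂ ∈ A, ∃ b₂ ∈ B, ∃ (P : G.Walk a₁ v) (Q : G.Walk a₂ b₂),
      Q.IsPath ∧ ∀ x ∈ P.support, x ∉ Q.support := by
  classical
  induction W with
  | @nil a =>
    obtain ⟨a₂, ha₂, b₂, hb₂, W, hW⟩ := hsep a
    refine ⟨a, ha, a₂, ha₂, b₂, hb₂, nil, W.bypass, bypass_isPath _, ?_⟩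
    simp only [support_nil, List.mem_singleton, forall_eq]
    exact fun h => hW (support_bypass_subset_support _ h)
  | @cons v' v a h W ih =>
    obtain ⟨a₁, ha₁, a₂, ha₂, b₂, hb₂, P, Q, hQ, hPQ⟩ := ih ha
    by_cases hvP : v' ∈ P.support
    · exact ⟨a₁, ha₁, a₂, ha₂, b₂, hb₂, P.takeUntil v' hvP, Q, hQ,
        fun x hx => hPQ x (support_takeUntil_subset_support _ _ hx)⟩
    by_cases hvQ : v' ∈ Q.support
    · set Q' := Q.takeUntil v' hvQ
      have hQ'p : Q'.IsPath := hQ.takeUntil _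
      have hPQ' : ∀ x ∈ P.support, x ∉ Q'.support :=
        fun x hx hx' => hPQ x hx (support_takeUntil_subset_support _ _ hx')
      obtain ⟨a₃, ha₃, b₃, hb₃, W, hW⟩ := hsep v'
      obtain h0 | ⟨x, W', hx, h1, h2⟩ :=
        exists_suffix_of_mem W {x | x ∈ P.support ∨ x ∈ Q'.support}
      · refine ⟨a₂, ha₂, a₃, ha₃, b₃, hb₃, Q', W.bypass, bypass_isPath _, fun x hx hx' => ?_⟩
        exact h0 x (support_bypass_subset_support _ hx') (Or.inr hx)
      rcases hx with hx | hx
      · refine ⟨a₂, ha₂, a₁, ha₁, b₃, hb₃, Q', ((P.takeUntil x hx).append W').bypass,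
          bypass_isPath _, fun z hz hz' => ?_⟩
        rcases (mem_support_append_iff _ _).1 (support_bypass_subset_support _ hz') with hz' | hz'
        · exact hPQ' z (support_takeUntil_subset_support _ _ hz') hz
        · have := h1 z hz' (Or.inr hz)
          subst this
          exact hPQ' z hx hz
      · have hxv : x ≠ v' := fun hxv => hW (h2 (hxv ▸ W'.start_mem_support))
        refine ⟨a₁, ha₁, a₂, ha₂, b₃, hb₃, P.concat h.symm, ((Q'.takeUntil x hx).append W').bypass,
          bypass_isPath _, fun z hz hz' => ?_⟩
        simp only [support_concat, List.mem_append, List.mem_singleton] at hz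
        rcases (mem_support_append_iff _ _).1 (support_bypass_subset_support _ hz') with hzQ | hzW
        · rcases hz with hz | rfl
          · exact hPQ' z hz (support_takeUntil_subset_support _ _ hzQ)
          · exact endpoint_notMem_support_takeUntil hQ'p hx hxv.symm hzQ
        · rcases hz with hz | rfl
          · have := h1 z hzW (Or.inl hz)
            subst this
            exact hPQ' z hz hx
          · exact hW (h2 hzW)
    · refine ⟨a₁, ha₁, a₂, ha₂, b₂, hb₂, P.concat h.symm, Q, hQ, fun x hx => ?_⟩
      simp only [support_concat, List.mem_append, List.mem_singleton] at hx
      rcases hx with hx | rfl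
      · exact hPQ x hx
      · exact hvQ

/-- **Menger's theorem** for two paths. -/
theorem exists_disjoint_paths {A B : Set V}
    (hsep : ∀ s, ∃ a ∈ A, ∃ b ∈ B, ∃ W : G.Walk a b, s ∉ W.support) (hA : A.Nonempty) :
    ∃ (a₁ b₁ a₂ b₂ : V) (P : G.Walk a₁ b₁) (Q : G.Walk a₂ b₂), a₁ ∈ A ∧ b₁ ∈ B ∧ a₂ ∈ A ∧
      b₂ ∈ B ∧ P.IsPath ∧ Q.IsPath ∧ (∀ x ∈ P.support, x ∉ Q.support) ∧
      (∀ v ∈ P.support, v ∈ A → v = a₁) ∧ (∀ v ∈ P.support, v ∈ B → v = b₁) ∧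
      (∀ v ∈ Q.support, v ∈ A → v = a₂) ∧ ∀ v ∈ Q.support, v ∈ B → v = b₂ := by
  obtain ⟨s, -⟩ := hA
  obtain ⟨a, ha, b, hb, W, -⟩ := hsep s
  obtain ⟨a₁, ha₁, a₂, ha₂, b₂, hb₂, P, Q, hQ, hPQ⟩ := exists_disjoint_walks_aux hsep ha W.reverse
  obtain ⟨x, y, P', hx, hy, hP', h1, h2, h3⟩ := exists_isPath_between ha₁ hb P
  obtain ⟨x', y', Q', hx', hy', hQ', h1', h2', h3'⟩ := exists_isPath_between ha₂ hb₂ Q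
  exact ⟨x, y, x', y', P', Q', hx, hy, hx', hy', hP', hQ',
    fun z hz hz' => hPQ z (h1 hz) (h1' hz'), h2, h3, h2', h3'⟩

end Paths

section Theta

variable {V : Type*} {G : SimpleGraph V}

/-- Two walks with common ends that have no further vertex and no edge in common, provided
they are paths. -/
def Parallel {p q : V} (A B : G.Walk p q) : Prop :=
  (∀ v ∈ A.support, v ∈ B.support → v = p ∨ v = q) ∧ ¬(s(p, q) ∈ A.edges ∧ s(p, q) ∈ B.edges)

theorem Parallel.symm {p q : V} {A B : G.Walk p q} (h : Parallel A B) : Parallel B A :=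
  ⟨fun v h1 h2 => h.1 v h2 h1, fun h' => h.2 h'.symm⟩

theorem Parallel.reverse {p q : V} {A B : G.Walk p q} (h : Parallel A B) :
    Parallel A.reverse B.reverse := by
  refine ⟨fun v h1 h2 => ?_, fun hpq => h.2 ?_⟩
  · rw [support_reverse, List.mem_reverse] at h1 h2
    exact (h.1 v h1 h2).symm
  · simpa [Sym2.eq_swap] using hpq

/-- Paths with an inner vertex are parallel to every path disjoint from them up to the ends. -/
theorem Parallel.of_inner {p q : V} {A B : G.Walk p q} (hA : A.IsPath) {x : V}
    (hx : x ∈ A.support) (hp : x ≠ p) (hq : x ≠ q)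
    (h : ∀ v ∈ A.support, v ∈ B.support → v = p ∨ v = q) : Parallel A B :=
  ⟨h, fun h' => (IsPath.eq_or_eq_of_mem_edges hA h'.1 hx).elim hp hq⟩

/-- The edges of parallel paths are disjoint. -/
theorem Parallel.notMem_edges {p q : V} {A B : G.Walk p q} (h : Parallel A B) {e : Sym2 V}
    (he : e ∈ A.edges) : e ∉ B.edges := by
  intro heB
  induction e with
  | h x y =>
    have hxy := A.adj_of_mem_edges he
    have hx := h.1 x (A.fst_mem_support_of_mem_edges he) (B.fst_mem_support_of_mem_edges heB)
    have hy := h.1 y (A.snd_mem_support_of_mem_edges he) (B.snd_mem_support_of_mem_edges heB)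
    have : s(x, y) = s(p, q) := by
      rcases hx with rfl | rfl <;> rcases hy with rfl | rfl
      · exact absurd rfl hxy.ne
      · rfl
      · exact Sym2.eq_swap
      · exact absurd rfl hxy.ne
    exact h.2 ⟨this ▸ he, this ▸ heB⟩

/-- Two parallel paths with distinct ends, forming a cycle. -/
structure IsBigon {p q : V} (A B : G.Walk p q) : Prop where
  ne : p ≠ q
  left : A.IsPath
  right : B.IsPath
  par : Parallel A B

/-- Three parallel paths with distinct ends. -/
structure IsTheta {p q : V} (A B C : G.Walk p q) : Prop where
  ne : p ≠ q
  fst : A.IsPath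
  snd : B.IsPath
  trd : C.IsPath
  par₁₂ : Parallel A B
  par₁₃ : Parallel A C
  par₂₃ : Parallel B C

theorem IsBigon.symm {p q : V} {A B : G.Walk p q} (h : IsBigon A B) : IsBigon B A :=
  ⟨h.ne, h.right, h.left, h.par.symm⟩

theorem IsBigon.reverse {p q : V} {A B : G.Walk p q} (h : IsBigon A B) :
    IsBigon A.reverse B.reverse :=
  ⟨h.ne.symm, h.left.reverse, h.right.reverse, h.par.reverse⟩

theorem IsTheta.swap {p q : V} {A B C : G.Walk p q} (h : IsTheta A B C) : IsTheta B A C :=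
  ⟨h.ne, h.snd, h.fst, h.trd, h.par₁₂.symm, h.par₂₃, h.par₁₃⟩

theorem IsTheta.rotate {p q : V} {A B C : G.Walk p q} (h : IsTheta A B C) : IsTheta B C A :=
  ⟨h.ne, h.snd, h.trd, h.fst, h.par₂₃, h.par₁₂.symm, h.par₁₃.symm⟩

theorem IsTheta.reverse {p q : V} {A B C : G.Walk p q} (h : IsTheta A B C) :
    IsTheta A.reverse B.reverse C.reverse :=
  ⟨h.ne.symm, h.fst.reverse, h.snd.reverse, h.trd.reverse, h.par₁₂.reverse, h.par₁₃.reverse,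
    h.par₂₃.reverse⟩

/-- The graph contains a theta through all edges in `E`. -/
def HasTheta (G : SimpleGraph V) (E : Set (Sym2 V)) : Prop :=
  ∃ (p q : V) (A B C : G.Walk p q), IsTheta A B C ∧
    ∀ e ∈ E, e ∈ A.edges ∨ e ∈ B.edges ∨ e ∈ C.edges

/-- A vertex of a bigon other than one of its ends can be made the first end. -/
theorem IsBigon.exists_move {p q : V} {A B : G.Walk p q} (h : IsBigon A B) {u : V}
    (hu : u ∈ A.support ∨ u ∈ B.support) (huq : u ≠ q) :
    ∃ A' B' : G.Walk u q, IsBigon A' B' ∧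
      (∀ v, v ∈ A'.support ∨ v ∈ B'.support ↔ v ∈ A.support ∨ v ∈ B.support) ∧
      ∀ e, e ∈ A'.edges ∨ e ∈ B'.edges ↔ e ∈ A.edges ∨ e ∈ B.edges := by
  classical
  wlog huA : u ∈ A.support generalizing A B
  · obtain ⟨A', B', h1, h2, h3⟩ := this h.symm hu.symm (hu.resolve_left huA)
    exact ⟨A', B', h1, fun v => by rw [h2, or_comm], fun e => by rw [h3, or_comm]⟩
  by_cases hup : u = p
  · subst hup
    exact ⟨A, B, h, fun _ => Iff.rfl, fun _ => Iff.rfl⟩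
  obtain ⟨A₁, A₂, -, -, rfl⟩ := h.left.mem_support_iff_exists_append.1 huA
  have hA := isPath_append_iff.1 h.left
  have hpar := h.par.1
  simp only [mem_support_append_iff] at hpar
  have hp : p ∉ A₂.support := fun hp => hup (hA.2.2 p A₁.start_mem_support hp).symm
  have hq : q ∉ A₁.support := fun hq => huq (hA.2.2 q hq A₂.end_mem_support).symm
  have hpath : (A₁.reverse.append B).IsPath := by
    rw [isPath_append_iff]
    refine ⟨hA.1.reverse, h.right, fun x hx hxB => ?_⟩
    rw [support_reverse, List.mem_reverse] at hx
    rcases hpar x (Or.inl hx) hxB with rfl | rfl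
    · rfl
    · exact absurd hx hq
  refine ⟨A₂, A₁.reverse.append B, ⟨huq, hA.2.1, hpath, ?_⟩, fun v => ?_, fun e => ?_⟩
  · refine (Parallel.of_inner hpath (x := p) (by simp) (Ne.symm hup) h.ne fun v hv hv2 => ?_).symm
    rw [mem_support_append_iff, support_reverse, List.mem_reverse] at hv
    rcases hv with hv | hv
    · exact Or.inl (hA.2.2 v hv hv2)
    · rcases hpar v (Or.inr hv2) hv with rfl | rfl
      · exact absurd hv2 hp
      · exact Or.inr rfl
  · simp only [mem_support_append_iff, support_reverse, List.mem_reverse]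
    tauto
  · simp only [edges_append, edges_reverse, List.mem_append, List.mem_reverse]
    tauto

/-- Any two vertices of a bigon can be made its ends. -/
theorem IsBigon.exists_split {p q : V} {A B : G.Walk p q} (h : IsBigon A B) {u w : V}
    (hu : u ∈ A.support ∨ u ∈ B.support) (hw : w ∈ A.support ∨ w ∈ B.support) (huw : u ≠ w) :
    ∃ A' B' : G.Walk u w, IsBigon A' B' ∧
      (∀ v, v ∈ A'.support ∨ v ∈ B'.support ↔ v ∈ A.support ∨ v ∈ B.support) ∧
      ∀ e, e ∈ A'.edges ∨ e ∈ B'.edges ↔ e ∈ A.edges ∨ e ∈ B.edges := by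
  wlog huq : u ≠ q generalizing p q
  · obtain rfl : u = q := not_not.1 huq
    obtain ⟨A', B', h1, h2, h3⟩ := this h.reverse (by simp) (by simpa using hw) h.ne.symm
    exact ⟨A', B', h1, fun v => by simpa using h2 v, fun v => by simpa using h3 v⟩
  obtain ⟨A₁, B₁, h1, h2, h3⟩ := h.exists_move hu huq
  obtain ⟨A₂, B₂, h4, h5, h6⟩ := h1.reverse.exists_move (u := w)
    (by simpa using (h2 w).2 hw) huw.symm
  refine ⟨A₂.reverse, B₂.reverse, h4.reverse, fun v => ?_, fun e => ?_⟩
  · simpa using (h5 v).trans (by simpa using h2 v)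
  · simpa using (h6 e).trans (by simpa using h3 e)

/-- `G` remains connected when two vertices are removed. -/
def Connected₃ (G : SimpleGraph V) : Prop :=
  ∀ s t x y : V, x ≠ s → x ≠ t → y ≠ s → y ≠ t →
    ∃ W : G.Walk x y, s ∉ W.support ∧ t ∉ W.support

/-- Every edge outside a subgraph with two vertices lies on an ear of that subgraph. -/
theorem exists_ear (hG : Connected₃ G) {e : Sym2 V} (he : e ∈ G.edgeSet) {S : Set V}
    (hS : S.Nontrivial) {F : Set (Sym2 V)} (hF : ∀ x y, s(x, y) ∈ F → x ∈ S ∧ y ∈ S)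
    (heF : e ∉ F) :
    ∃ (u w : V) (R : G.Walk u w), u ≠ w ∧ u ∈ S ∧ w ∈ S ∧ R.IsPath ∧ e ∈ R.edges ∧
      (∀ v ∈ R.support, v ∈ S → v = u ∨ v = w) ∧ ∀ e' ∈ R.edges, e' ∉ F := by
  induction e with
  | h a b =>
    have hab : G.Adj a b := he
    have hsep : ∀ s, ∃ x ∈ ({a, b} : Set V), ∃ y ∈ S, ∃ W : G.Walk x y, s ∉ W.support := by
      intro s
      have h1 : ∃ x ∈ ({a, b} : Set V), x ≠ s := by
        by_cases h : a = s
        · exact ⟨b, by simp, fun hb => hab.ne (h.trans hb.symm)⟩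
        · exact ⟨a, by simp, h⟩
      obtain ⟨x, hx, hxs⟩ := h1
      obtain ⟨y, hy, hys⟩ := hS.exists_ne s
      obtain ⟨W, hW, -⟩ := hG s s x y hxs hxs hys hys
      exact ⟨x, hx, y, hy, W, hW⟩
    obtain ⟨a₁, b₁, a₂, b₂, P, Q, ha₁, hb₁, ha₂, hb₂, hP, hQ, hPQ, -, hPS, -, hQS⟩ :=
      exists_disjoint_paths hsep ⟨a, by simp⟩
    have ha₁₂ : a₁ ≠ a₂ := fun h => hPQ a₁ P.start_mem_support (h ▸ Q.start_mem_support)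
    have hadj : G.Adj a₁ a₂ ∧ s(a, b) = s(a₁, a₂) := by
      rcases ha₁ with rfl | rfl <;> rcases ha₂ with rfl | rfl
      · exact absurd rfl ha₁₂
      · exact ⟨hab, rfl⟩
      · exact ⟨hab.symm, Sym2.eq_swap⟩
      · exact absurd rfl ha₁₂
    obtain ⟨hadj, hs⟩ := hadj
    have hR : (P.reverse.append (cons hadj Q)).IsPath := by
      rw [isPath_append_iff, cons_isPath_iff]
      refine ⟨hP.reverse, ⟨hQ, hPQ _ P.start_mem_support⟩, fun x hx hx' => ?_⟩
      rw [support_reverse, List.mem_reverse] at hx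
      rw [support_cons, List.mem_cons] at hx'
      exact hx'.resolve_right (hPQ x hx)
    have heR : s(a, b) ∈ (P.reverse.append (cons hadj Q)).edges := by simp [hs]
    have hb : b₁ ≠ b₂ := fun h => hPQ b₁ P.end_mem_support (h ▸ Q.end_mem_support)
    have hmeet : ∀ v ∈ (P.reverse.append (cons hadj Q)).support, v ∈ S → v = b₁ ∨ v = b₂ := by
      intro v hv hvS
      rw [mem_support_append_iff, support_reverse, List.mem_reverse, support_cons,
        List.mem_cons] at hv
      rcases hv with hv | rfl | hv
      · exact Or.inl (hPS v hv hvS)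
      · exact Or.inl (hPS _ P.start_mem_support hvS)
      · exact Or.inr (hQS v hv hvS)
    refine ⟨b₁, b₂, P.reverse.append (cons hadj Q), hb, hb₁, hb₂, hR, heR, hmeet, ?_⟩
    intro e' hf hfF
    induction e' with
    | h x y =>
      have hxy := adj_of_mem_edges _ hf
      have hx := hmeet x (fst_mem_support_of_mem_edges _ hf) (hF x y hfF).1
      have hy := hmeet y (snd_mem_support_of_mem_edges _ hf) (hF x y hfF).2
      have hxy' : s(x, y) = s(b₁, b₂) := by
        rcases hx with rfl | rfl <;> rcases hy with rfl | rfl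
        · exact absurd rfl hxy.ne
        · rfl
        · exact Sym2.eq_swap
        · exact absurd rfl hxy.ne
      rw [hxy'] at hf hfF
      exact heF (IsPath.edge_eq_of_mem_edges hR hf heR ▸ hfF)

/-- An edge outside a cycle extends it to a theta. -/
theorem IsBigon.exists_theta (hG : Connected₃ G) {p q : V} {A B : G.Walk p q} (h : IsBigon A B)
    {e : Sym2 V} (he : e ∈ G.edgeSet) (heA : e ∉ A.edges) (heB : e ∉ B.edges) :
    ∃ (u w : V) (A' B' R : G.Walk u w), IsTheta A' B' R ∧ e ∈ R.edges ∧
      ∀ e, e ∈ A'.edges ∨ e ∈ B'.edges ↔ e ∈ A.edges ∨ e ∈ B.edges := by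
  obtain ⟨u, w, R, huw, hu, hw, hR, heR, hRS, hRF⟩ := exists_ear hG he
    (S := {v | v ∈ A.support ∨ v ∈ B.support}) (F := {e | e ∈ A.edges ∨ e ∈ B.edges})
    ⟨p, by simp, q, by simp, h.ne⟩
    (fun x y hxy => hxy.elim
      (fun h => ⟨Or.inl (fst_mem_support_of_mem_edges _ h),
        Or.inl (snd_mem_support_of_mem_edges _ h)⟩)
      (fun h => ⟨Or.inr (fst_mem_support_of_mem_edges _ h),
        Or.inr (snd_mem_support_of_mem_edges _ h)⟩))
    (by simp [heA, heB])
  obtain ⟨A', B', h1, h2, h3⟩ := h.exists_split hu hw huw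
  refine ⟨u, w, A', B', R, ⟨huw, h1.left, h1.right, hR, h1.par,
    ⟨fun v hv hvR => hRS v hvR ((h2 v).1 (Or.inl hv)), fun hpq => ?_⟩,
    ⟨fun v hv hvR => hRS v hvR ((h2 v).1 (Or.inr hv)), fun hpq => ?_⟩⟩, heR, h3⟩
  · exact hRF _ hpq.2 ((h3 _).1 (Or.inl hpq.1))
  · exact hRF _ hpq.2 ((h3 _).1 (Or.inr hpq.1))

/-- At most three edges at a vertex of a cubic graph. -/
theorem exists_mem_edges_of_four {p a b c d : V} (hp : (G.neighborSet p).encard ≤ 3)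
    (ha : G.Adj p a) (hb : G.Adj p b) (hc : G.Adj p c) (hd : G.Adj p d) (hab : a ≠ b)
    (hac : a ≠ c) (hbc : b ≠ c) : d = a ∨ d = b ∨ d = c := by
  by_contra! h
  have h1 : ({d, a, b, c} : Set V) ⊆ G.neighborSet p := by
    rintro x (rfl | rfl | rfl | rfl) <;> assumption
  have h2 := (Set.encard_le_encard h1).trans hp
  rw [Set.encard_insert_of_notMem (by simp [h.1, h.2.1, h.2.2]),
    Set.encard_insert_of_notMem (by simp [hab, hac]), Set.encard_pair hbc] at h2
  exact absurd h2 (by decide)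

/-- A cycle in a graph of minimum degree three misses some edge. -/
theorem IsBigon.exists_edge_notMem {p q : V} {A B : G.Walk p q} (h : IsBigon A B)
    (hp : 3 ≤ (G.neighborSet p).encard) : ∃ e ∈ G.edgeSet, e ∉ A.edges ∧ e ∉ B.edges := by
  by_contra! hcon
  have hsub : G.neighborSet p ⊆ {A.snd, B.snd} := by
    intro z hz
    by_cases hA : s(p, z) ∈ A.edges
    · exact Or.inl (h.left.eq_snd_of_mem_edges hA)
    · exact Or.inr (h.right.eq_snd_of_mem_edges (hcon _ hz hA))
  have h2 := hp.trans ((Set.encard_le_encard hsub).trans (Set.encard_insert_le _ _))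
  rw [Set.encard_singleton] at h2
  exact absurd h2 (by decide)

/-- If three of four edges lie on a cycle, then all four lie on a theta. -/
theorem IsBigon.hasTheta (hG : Connected₃ G) (hd : ∀ v, 3 ≤ (G.neighborSet v).encard)
    {p q : V} {A B : G.Walk p q} (h : IsBigon A B) {E : Set (Sym2 V)} {e : Sym2 V}
    (he : e ∈ G.edgeSet) (hE : ∀ e' ∈ E, e' = e ∨ e' ∈ A.edges ∨ e' ∈ B.edges) :
    HasTheta G E := by
  obtain ⟨e₀, he₀, hA, hB, h0⟩ : ∃ e₀ ∈ G.edgeSet, e₀ ∉ A.edges ∧ e₀ ∉ B.edges ∧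
      ∀ e' ∈ E, e' = e₀ ∨ e' ∈ A.edges ∨ e' ∈ B.edges := by
    by_cases heAB : e ∈ A.edges ∨ e ∈ B.edges
    · obtain ⟨e₀, he₀, hA, hB⟩ := h.exists_edge_notMem (hd p)
      refine ⟨e₀, he₀, hA, hB, fun e' he' => Or.inr ?_⟩
      rcases hE e' he' with rfl | h'
      · exact heAB
      · exact h'
    · exact ⟨e, he, fun h => heAB (Or.inl h), fun h => heAB (Or.inr h), hE⟩
  obtain ⟨u, w, A', B', R, h1, h2, h3⟩ := h.exists_theta hG he₀ hA hB
  refine ⟨u, w, A', B', R, h1, fun e' he' => ?_⟩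
  rcases h0 e' he' with rfl | h'
  · exact Or.inr (Or.inr h2)
  · exact ((h3 e').2 h').elim Or.inl fun h => Or.inr (Or.inl h)

/-- Any two edges lie on a cycle. -/
theorem exists_bigon (hG : Connected₃ G) {e₁ e₂ : Sym2 V} (h₁ : e₁ ∈ G.edgeSet)
    (h₂ : e₂ ∈ G.edgeSet) (hne : e₁ ≠ e₂) :
    ∃ (p q : V) (A B : G.Walk p q), IsBigon A B ∧ e₁ ∈ A.edges ∧ e₂ ∈ B.edges := by
  induction e₂ with
  | h a b =>
    have hab : G.Adj a b := h₂
    obtain ⟨u, w, R, huw, hu, hw, hR, heR, hRS, hRF⟩ := exists_ear hG h₁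
      (S := {a, b}) (F := {s(a, b)}) ⟨a, by simp, b, by simp, hab.ne⟩
      (fun x y hxy => by
        rcases Sym2.eq_iff.1 (Set.mem_singleton_iff.1 hxy) with ⟨rfl, rfl⟩ | ⟨rfl, rfl⟩ <;> simp)
      (by simpa using hne)
    have hadj : G.Adj u w ∧ s(a, b) = s(u, w) := by
      rcases hu with rfl | rfl <;> rcases hw with rfl | rfl
      · exact absurd rfl huw
      · exact ⟨hab, rfl⟩
      · exact ⟨hab.symm, Sym2.eq_swap⟩
      · exact absurd rfl huw
    refine ⟨u, w, R, hadj.1.toWalk, ⟨huw, hR, hadj.1.isPath_toWalk, fun v _ hv => ?_, fun h => ?_⟩,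
      heR, by simp [hadj.2]⟩
    · simpa using hv
    · exact hRF _ h.1 hadj.2.symm

end Theta

section FourEdges

variable {V : Type*} {G : SimpleGraph V}

/-- A theta together with a path that joins inner points of two of its arms. -/
theorem IsTheta.hasTheta_of_chord_aux {p q u w : V} {A₁ : G.Walk p u} {A₂ : G.Walk u q}
    {B₁ : G.Walk p w} {B₂ : G.Walk w q} {C : G.Walk p q} {R : G.Walk u w}
    (h : IsTheta (A₁.append A₂) (B₁.append B₂) C) (hR : R.IsPath)
    (hup : u ≠ p) (huq : u ≠ q) (hwp : w ≠ p) (hwq : w ≠ q)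
    (hRA : ∀ v ∈ R.support, v ∈ A₁.support ∨ v ∈ A₂.support ∨ v ∈ B₁.support ∨ v ∈ B₂.support ∨
      v ∈ C.support → v = u ∨ v = w)
    {E : Set (Sym2 V)} {e₁ e₂ e₃ e₄ : Sym2 V} (h₁ : e₁ ∈ A₂.edges)
    (h₂ : e₂ ∈ B₁.edges ∨ e₂ ∈ B₂.edges) (h₃ : e₃ ∈ C.edges) (h₄ : e₄ ∈ R.edges)
    (hE : ∀ e ∈ E, e = e₁ ∨ e = e₂ ∨ e = e₃ ∨ e = e₄) : HasTheta G E := by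
  obtain ⟨hne, hA, hB, hC, hAB, hAC, hBC⟩ := h
  rw [isPath_append_iff] at hA hB
  replace hAB := hAB.1
  replace hAC := hAC.1
  replace hBC := hBC.1
  simp only [mem_support_append_iff] at hAB hAC hBC
  have s₁ := A₁.start_mem_support
  have s₂ := A₁.end_mem_support
  have s₃ := A₂.start_mem_support
  have s₄ := A₂.end_mem_support
  have s₅ := B₁.start_mem_support
  have s₆ := B₁.end_mem_support
  have s₇ := B₂.start_mem_support
  have s₈ := B₂.end_mem_support
  have s₉ := C.start_mem_support
  have t₁ := C.end_mem_support
  have t₂ := R.start_mem_support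
  have t₃ := R.end_mem_support
  have hwu : w ≠ u := by
    rintro rfl
    exact (hAB w (Or.inl s₂) (Or.inl s₆)).elim hwp hwq
  rcases h₂ with h₂ | h₂
  · have hX : (C.append A₂.reverse).IsPath := by
      rw [isPath_append_iff]
      simp only [support_reverse, List.mem_reverse, isPath_reverse_iff]
      grind
    have hY : (B₁.append R.reverse).IsPath := by
      rw [isPath_append_iff]
      simp only [support_reverse, List.mem_reverse, isPath_reverse_iff]
      grind
    refine ⟨p, u, A₁, C.append A₂.reverse, B₁.append R.reverse, ⟨hup.symm, hA.1, hX, hY,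
      (Parallel.of_inner hX (x := q) (by simp) hne.symm huq.symm ?_).symm,
      (Parallel.of_inner hY (x := w) (by simp) hwp hwu ?_).symm,
      Parallel.of_inner hX (x := q) (by simp) hne.symm huq.symm ?_⟩, ?_⟩
    all_goals
      simp only [support_reverse, List.mem_reverse, mem_support_append_iff, edges_append,
        edges_reverse, List.mem_append]
      grind
  · have hX : (C.reverse.append A₁).IsPath := by
      rw [isPath_append_iff]
      simp only [support_reverse, List.mem_reverse, isPath_reverse_iff]
      grind
    have hY : (B₂.reverse.append R.reverse).IsPath := by
      rw [isPath_append_iff]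
      simp only [support_reverse, List.mem_reverse, isPath_reverse_iff]
      grind
    refine ⟨q, u, A₂.reverse, C.reverse.append A₁, B₂.reverse.append R.reverse,
      ⟨huq.symm, hA.2.1.reverse, hX, hY,
      (Parallel.of_inner hX (x := p) (by simp) hne hup.symm ?_).symm,
      (Parallel.of_inner hY (x := w) (by simp) hwq hwu ?_).symm,
      Parallel.of_inner hX (x := p) (by simp) hne hup.symm ?_⟩, ?_⟩
    all_goals
      simp only [support_reverse, List.mem_reverse, mem_support_append_iff, edges_append,
        edges_reverse, List.mem_append]
      grind

theorem IsTheta.hasTheta_of_chord {p q u w : V} {A B C : G.Walk p q} {R : G.Walk u w}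
    (h : IsTheta A B C) (hR : R.IsPath) (hu : u ∈ A.support) (hw : w ∈ B.support)
    (hup : u ≠ p) (huq : u ≠ q) (hwp : w ≠ p) (hwq : w ≠ q)
    (hRA : ∀ v ∈ R.support, v ∈ A.support ∨ v ∈ B.support ∨ v ∈ C.support → v = u ∨ v = w)
    {E : Set (Sym2 V)} {e₁ e₂ e₃ e₄ : Sym2 V} (h₁ : e₁ ∈ A.edges) (h₂ : e₂ ∈ B.edges)
    (h₃ : e₃ ∈ C.edges) (h₄ : e₄ ∈ R.edges)
    (hE : ∀ e ∈ E, e = e₁ ∨ e = e₂ ∨ e = e₃ ∨ e = e₄) : HasTheta G E := by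
  classical
  obtain ⟨A₁, A₂, -, -, rfl⟩ := h.fst.mem_support_iff_exists_append.1 hu
  obtain ⟨B₁, B₂, -, -, rfl⟩ := h.snd.mem_support_iff_exists_append.1 hw
  simp only [mem_support_append_iff, edges_append, List.mem_append] at hRA h₁ h₂
  rcases h₁ with h₁ | h₁
  · have h' := h.reverse
    rw [reverse_append, reverse_append] at h'
    refine h'.hasTheta_of_chord_aux hR huq hup hwq hwp (fun v hv hv' => hRA v hv ?_)
      (by simpa using h₁) (e₂ := e₂) (by simpa [or_comm] using h₂) (e₃ := e₃) (by simpa using h₃)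
      h₄ hE
    simp only [support_reverse, List.mem_reverse] at hv'
    tauto
  · exact h.hasTheta_of_chord_aux hR hup huq hwp hwq (fun v hv hv' => hRA v hv (by tauto))
      h₁ h₂ h₃ h₄ hE

/-- Two disjoint cycles joined by two disjoint paths that attach to one side of the first cycle. -/
theorem hasTheta_of_two_paths {x₁ x₄ y₁ y₄ p q : V} {I : G.Walk x₁ x₄} {J : G.Walk y₁ y₄}
    {A B : G.Walk p q} (hI : I.IsPath) (hJ : J.IsPath) (hIJ : ∀ v ∈ I.support, v ∉ J.support)
    (h₁ : G.Adj x₁ y₁) (h₄ : G.Adj x₄ y₄) (hAB : IsBigon A B)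
    (hIA : ∀ v, v ∈ I.support ∨ v ∈ J.support → ¬(v ∈ A.support ∨ v ∈ B.support))
    {a₁ b₁ a₂ b₂ : V} {P : G.Walk a₁ b₁} {Q : G.Walk a₂ b₂} (hP : P.IsPath) (hQ : Q.IsPath)
    (hPQ : ∀ v ∈ P.support, v ∉ Q.support) (ha₁ : a₁ ∈ I.support) (ha₂ : a₂ ∈ I.support)
    (hb₁ : b₁ ∈ A.support ∨ b₁ ∈ B.support) (hb₂ : b₂ ∈ A.support ∨ b₂ ∈ B.support)
    (hPI : ∀ v ∈ P.support, v ∈ I.support → v = a₁) (hQI : ∀ v ∈ Q.support, v ∈ I.support → v = a₂)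
    (hPJ : ∀ v ∈ P.support, v ∉ J.support) (hQJ : ∀ v ∈ Q.support, v ∉ J.support)
    (hPA : ∀ v ∈ P.support, v ∈ A.support ∨ v ∈ B.support → v = b₁)
    (hQA : ∀ v ∈ Q.support, v ∈ A.support ∨ v ∈ B.support → v = b₂)
    {E : Set (Sym2 V)}
    (hE : ∀ e ∈ E, e = s(x₁, y₁) ∨ e = s(x₄, y₄) ∨ e ∈ A.edges ∨ e ∈ B.edges) :
    HasTheta G E := by
  classical
  have ha : a₁ ≠ a₂ := fun h => hPQ a₁ P.start_mem_support (h ▸ Q.start_mem_support)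
  have hb : b₁ ≠ b₂ := fun h => hPQ b₁ P.end_mem_support (h ▸ Q.end_mem_support)
  wlog hord : ∃ (I₁ : G.Walk x₁ a₁) (I₂ : G.Walk a₁ a₂) (I₃ : G.Walk a₂ x₄),
      I = I₁.append (I₂.append I₃) generalizing a₁ a₂ b₁ b₂
  · exact this hQ hP (fun v h h' => hPQ v h' h) ha₂ ha₁ hb₂ hb₁ hQI hPI hQJ hPJ hQA hPA ha.symm
      hb.symm ((exists_append_append_of_mem I ha₁ ha₂).resolve_left hord)
  obtain ⟨A', B', hAB', hs, hedge⟩ := hAB.exists_split hb₁ hb₂ hb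
  obtain ⟨I₁, I₂, I₃, rfl⟩ := hord
  simp only [isPath_append_iff, mem_support_append_iff] at hI hIJ hIA hPI hQI
  simp only [← hs] at hIA hPA hQA
  have s₁ := I₁.start_mem_support
  have s₂ := I₁.end_mem_support
  have s₃ := I₂.start_mem_support
  have s₄ := I₂.end_mem_support
  have s₅ := I₃.start_mem_support
  have s₆ := I₃.end_mem_support
  have s₇ := J.start_mem_support
  have s₈ := J.end_mem_support
  have s₉ := P.start_mem_support
  have t₁ := P.end_mem_support
  have t₂ := Q.start_mem_support
  have t₃ := Q.end_mem_support
  have hI₁₃ : ∀ v ∈ I₁.support, v ∉ I₃.support := by grind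
  have hT : (I₁.reverse.append (cons h₁ (J.append (cons h₄.symm I₃.reverse)))).IsPath := by
    simp only [isPath_append_iff, cons_isPath_iff, isPath_reverse_iff, mem_support_append_iff,
      support_cons, support_reverse, List.mem_cons, List.mem_reverse]
    grind
  have hTs : ∀ v, v ∈ (I₁.reverse.append (cons h₁ (J.append (cons h₄.symm I₃.reverse)))).support →
      v ∈ I₁.support ∨ v ∈ J.support ∨ v ∈ I₃.support := by
    simp only [mem_support_append_iff, support_cons, support_reverse, List.mem_cons,
      List.mem_reverse]
    grind
  have hTe : s(x₁, y₁) ∈ (I₁.reverse.append (cons h₁ (J.append (cons h₄.symm I₃.reverse)))).edges ∧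
      s(x₄, y₄) ∈ (I₁.reverse.append (cons h₁ (J.append (cons h₄.symm I₃.reverse)))).edges := by
    simp [Sym2.eq_swap]
  generalize I₁.reverse.append (cons h₁ (J.append (cons h₄.symm I₃.reverse))) = T at hT hTs hTe
  have hX : (P.reverse.append (T.append Q)).IsPath := by
    simp only [isPath_append_iff, isPath_reverse_iff, mem_support_append_iff, support_reverse,
      List.mem_reverse]
    grind
  have hXA : ∀ v ∈ (P.reverse.append (T.append Q)).support, v ∈ A'.support ∨ v ∈ B'.support →
      v = b₁ ∨ v = b₂ := by
    simp only [mem_support_append_iff, support_reverse, List.mem_reverse]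
    grind
  have ha₁A : a₁ ≠ b₁ ∧ a₁ ≠ b₂ := by grind
  refine ⟨b₁, b₂, P.reverse.append (T.append Q), A', B', ⟨hb, hX, hAB'.left, hAB'.right,
    Parallel.of_inner hX (x := a₁) (by simp) ha₁A.1 ha₁A.2 fun v hv hv' => hXA v hv (Or.inl hv'),
    Parallel.of_inner hX (x := a₁) (by simp) ha₁A.1 ha₁A.2 fun v hv hv' => hXA v hv (Or.inr hv'),
    hAB'.par⟩, fun e he => ?_⟩
  have := hedge e
  simp only [edges_append, List.mem_append]
  grind

/-- Some path from one of two disjoint sets to a third set avoids a given vertex, as well as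
one of the two sets, unless the two sets are separated from the third by two vertices. -/
theorem exists_not_separated (hG : Connected₃ G) {I J C : Set V}
    (hC : ∀ s t, ∃ v ∈ C, v ≠ s ∧ v ≠ t) (hD : ∀ s t, ∃ v ∈ I ∪ J, v ≠ s ∧ v ≠ t) :
    (∀ s, ∃ a ∈ I, ∃ b ∈ C, ∃ W : G.Walk a b, s ∉ W.support ∧ ∀ v ∈ W.support, v ∈ J → v = a) ∨
    ∀ s, ∃ a ∈ J, ∃ b ∈ C, ∃ W : G.Walk a b, s ∉ W.support ∧ ∀ v ∈ W.support, v ∈ I → v = a := by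
  by_contra! h
  obtain ⟨⟨s, hs⟩, t, ht⟩ := h
  obtain ⟨x, hx, hxs, hxt⟩ := hD s t
  obtain ⟨y, hy, hys, hyt⟩ := hC s t
  obtain ⟨W, hWs, hWt⟩ := hG s t x y hxs hxt hys hyt
  obtain h0 | ⟨z, W', hz, h1, h2⟩ := exists_suffix_of_mem W (I ∪ J)
  · exact h0 x W.start_mem_support hx
  · rcases hz with hz | hz
    · obtain ⟨v, hv, hvJ, hne⟩ := hs z hz y hy W' fun h => hWs (h2 h)
      exact hne (h1 v hv (Or.inr hvJ))
    · obtain ⟨v, hv, hvI, hne⟩ := ht z hz y hy W' fun h => hWt (h2 h)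
      exact hne (h1 v hv (Or.inl hvI))

/-- Two disjoint cycles, the first of which has a side that is not separated from the second
cycle by a vertex when the other side is removed. -/
theorem hasTheta_of_disjoint_aux {x₁ x₄ y₁ y₄ p q : V} {I : G.Walk x₁ x₄} {J : G.Walk y₁ y₄}
    {A B : G.Walk p q} (hI : I.IsPath) (hJ : J.IsPath) (hIJ : ∀ v ∈ I.support, v ∉ J.support)
    (h₁ : G.Adj x₁ y₁) (h₄ : G.Adj x₄ y₄) (hAB : IsBigon A B)
    (hIA : ∀ v, v ∈ I.support ∨ v ∈ J.support → ¬(v ∈ A.support ∨ v ∈ B.support))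
    (hsep : ∀ s, ∃ a ∈ {v | v ∈ I.support}, ∃ b ∈ {v | v ∈ A.support ∨ v ∈ B.support},
      ∃ W : G.Walk a b, s ∉ W.support ∧ ∀ v ∈ W.support, v ∈ {v | v ∈ J.support} → v = a)
    {E : Set (Sym2 V)}
    (hE : ∀ e ∈ E, e = s(x₁, y₁) ∨ e = s(x₄, y₄) ∨ e ∈ A.edges ∨ e ∈ B.edges) :
    HasTheta G E := by
  let H : SimpleGraph V :=
    { Adj := fun a b => G.Adj a b ∧ a ∉ J.support ∧ b ∉ J.support
      symm := ⟨fun a b h => ⟨h.1.symm, h.2.2, h.2.1⟩⟩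
      loopless := ⟨fun a h => h.1.ne rfl⟩ }
  have hHG : H ≤ G := fun a b h => h.1
  have hHJ : ∀ {a b : V} (P : H.Walk a b), a ∉ J.support → ∀ v ∈ P.support, v ∉ J.support := by
    intro a b P ha
    induction P with
    | nil => simpa using ha
    | cons h P ih =>
      rw [support_cons]
      exact List.forall_mem_cons.2 ⟨ha, ih h.2.2⟩
  have hsep' : ∀ s, ∃ a ∈ {v | v ∈ I.support}, ∃ b ∈ {v | v ∈ A.support ∨ v ∈ B.support},
      ∃ W : H.Walk a b, s ∉ W.support := by
    intro s
    obtain ⟨a, ha, b, hb, W, hs, hW⟩ := hsep s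
    have hWJ : ∀ v ∈ W.support, v ∉ J.support := fun v hv hvJ =>
      hIJ a ha (hW v hv hvJ ▸ hvJ)
    have hWH : ∀ e ∈ W.edges, e ∈ H.edgeSet := by
      intro e he
      induction e with
      | h x y =>
        exact ⟨W.adj_of_mem_edges he, hWJ x (W.fst_mem_support_of_mem_edges he),
          hWJ y (W.snd_mem_support_of_mem_edges he)⟩
    exact ⟨a, ha, b, hb, W.transfer H hWH, by rwa [support_transfer]⟩
  obtain ⟨a₁, b₁, a₂, b₂, P, Q, ha₁, hb₁, ha₂, hb₂, hP, hQ, hPQ, hPI, hPC, hQI, hQC⟩ :=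
    exists_disjoint_paths hsep' ⟨x₁, I.start_mem_support⟩
  exact hasTheta_of_two_paths (P := P.mapLe hHG) (Q := Q.mapLe hHG) hI hJ hIJ h₁ h₄ hAB hIA
    ((isPath_mapLe hHG).2 hP) ((isPath_mapLe hHG).2 hQ) (by simpa using hPQ) ha₁ ha₂ hb₁ hb₂
    (by simpa using hPI) (by simpa using hQI) (by simpa using hHJ P (hIJ _ ha₁))
    (by simpa using hHJ Q (hIJ _ ha₂)) (by simpa using hPC) (by simpa using hQC) hE

theorem IsBigon.exists_mem_ne {p q : V} {A B : G.Walk p q} (h : IsBigon A B) (s t : V) :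
    ∃ v, (v ∈ A.support ∨ v ∈ B.support) ∧ v ≠ s ∧ v ≠ t := by
  by_contra! hcon
  have hpq : ∀ v, v ∈ A.support ∨ v ∈ B.support → v = p ∨ v = q := by
    intro v hv
    have h1 := or_iff_not_imp_left.2 (hcon v hv)
    have h2 := or_iff_not_imp_left.2 (hcon p (by simp))
    have h3 := or_iff_not_imp_left.2 (hcon q (by simp))
    have h4 := h.ne
    clear hcon
    grind
  have key : ∀ {C : G.Walk p q}, (∀ v ∈ C.support, v = p ∨ v = q) → s(p, q) ∈ C.edges := by
    intro C hC
    have h1 := not_nil_of_ne h.ne (p := C)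
    have h2 := hC C.snd (C.snd_mem_support_of_mem_edges (mk_start_snd_mem_edges h1))
    have h3 := mk_start_snd_mem_edges h1
    rwa [h2.resolve_left (C.adj_snd h1).ne'] at h3
  exact h.par.2 ⟨key fun v hv => hpq v (Or.inl hv), key fun v hv => hpq v (Or.inr hv)⟩

/-- Two disjoint cycles in a 3-connected graph. -/
theorem hasTheta_of_disjoint (hG : Connected₃ G) {x₁ x₄ y₁ y₄ p q : V} {I : G.Walk x₁ x₄}
    {J : G.Walk y₁ y₄} {A B : G.Walk p q} (hI : I.IsPath) (hJ : J.IsPath)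
    (hIJ : ∀ v ∈ I.support, v ∉ J.support) (h₁ : G.Adj x₁ y₁) (h₄ : G.Adj x₄ y₄)
    (hne : s(x₁, y₁) ≠ s(x₄, y₄)) (hAB : IsBigon A B)
    (hIA : ∀ v, v ∈ I.support ∨ v ∈ J.support → ¬(v ∈ A.support ∨ v ∈ B.support))
    {E : Set (Sym2 V)}
    (hE : ∀ e ∈ E, e = s(x₁, y₁) ∨ e = s(x₄, y₄) ∨ e ∈ A.edges ∨ e ∈ B.edges) :
    HasTheta G E := by
  have hD : ∀ s t, ∃ v ∈ {v | v ∈ I.support} ∪ {v | v ∈ J.support}, v ≠ s ∧ v ≠ t := by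
    intro s t
    by_contra! hcon
    have e1 := or_iff_not_imp_left.2 (hcon x₁ (Or.inl I.start_mem_support))
    have e2 := or_iff_not_imp_left.2 (hcon x₄ (Or.inl I.end_mem_support))
    have e3 := or_iff_not_imp_left.2 (hcon y₁ (Or.inr J.start_mem_support))
    have e4 := or_iff_not_imp_left.2 (hcon y₄ (Or.inr J.end_mem_support))
    have n1 := h₁.ne
    have n2 := h₄.ne
    rw [Ne, Sym2.eq_iff] at hne
    clear hcon
    grind
  rcases exists_not_separated hG hAB.exists_mem_ne hD with h | h
  · exact hasTheta_of_disjoint_aux hI hJ hIJ h₁ h₄ hAB hIA h hE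
  · exact hasTheta_of_disjoint_aux hJ hI (fun v h h' => hIJ v h' h) h₁.symm h₄.symm hAB
      (fun v h => hIA v h.symm) h fun e he => by
        rw [Sym2.eq_swap (a := y₁), Sym2.eq_swap (a := y₄)]; exact hE e he

/-- A theta together with a path that joins inner points of the same arm, in their order. -/
theorem IsTheta.hasTheta_of_handle_aux (hG : Connected₃ G) {p q u w : V} {A₁ : G.Walk p u}
    {M : G.Walk u w} {A₂ : G.Walk w q} {B C : G.Walk p q} {R : G.Walk u w}
    (h : IsTheta (A₁.append (M.append A₂)) B C) (hR : R.IsPath)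
    (hup : u ≠ p) (huq : u ≠ q) (hwp : w ≠ p) (hwq : w ≠ q)
    (hRA : ∀ v ∈ R.support, v ∈ (A₁.append (M.append A₂)).support ∨ v ∈ B.support ∨
      v ∈ C.support → v = u ∨ v = w)
    {E : Set (Sym2 V)} {e₁ e₂ e₃ e₄ : Sym2 V} (h₁ : e₁ ∈ (A₁.append (M.append A₂)).edges)
    (h₂ : e₂ ∈ B.edges) (h₃ : e₃ ∈ C.edges) (h₄ : e₄ ∈ R.edges)
    (h₁₄ : e₁ ≠ e₄) (hE : ∀ e ∈ E, e = e₁ ∨ e = e₂ ∨ e = e₃ ∨ e = e₄) : HasTheta G E := by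
  obtain ⟨hne, hA, hB, hC, hAB, hAC, hBC⟩ := h
  simp only [isPath_append_iff] at hA
  replace hAB := hAB.1
  replace hAC := hAC.1
  simp only [mem_support_append_iff] at hA hAB hAC hRA
  simp only [edges_append, List.mem_append] at h₁
  have s₁ := A₁.start_mem_support
  have s₂ := A₁.end_mem_support
  have s₃ := M.start_mem_support
  have s₄ := M.end_mem_support
  have s₅ := A₂.start_mem_support
  have s₆ := A₂.end_mem_support
  by_cases h₁' : e₁ ∈ M.edges
  · obtain ⟨x₁, y₁, g, M₁, M₂, rfl, rfl⟩ := exists_append_cons_of_mem_edges M h₁'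
    obtain ⟨x₄, y₄, g', R₁, R₂, rfl, rfl⟩ := exists_append_cons_of_mem_edges R h₄
    simp only [isPath_append_iff, cons_isPath_iff, mem_support_append_iff, support_cons,
      List.mem_cons] at hA hR hAB hAC hRA
    have r₁ := M₁.start_mem_support
    have r₂ := M₁.end_mem_support
    have r₃ := M₂.start_mem_support
    have r₄ := M₂.end_mem_support
    have t₁ := R₁.start_mem_support
    have t₂ := R₁.end_mem_support
    have t₃ := R₂.start_mem_support
    have t₄ := R₂.end_mem_support
    refine hasTheta_of_disjoint hG (I := M₁.reverse.append R₁) (J := M₂.append R₂.reverse)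
      (A := B) (B := C) ?_ ?_ ?_ g g' h₁₄ ⟨hne, hB, hC, hBC⟩ ?_ ?_
    · simp only [isPath_append_iff, isPath_reverse_iff, support_reverse, List.mem_reverse]
      grind
    · simp only [isPath_append_iff, isPath_reverse_iff, support_reverse, List.mem_reverse]
      grind
    · simp only [mem_support_append_iff, support_reverse, List.mem_reverse]
      grind
    · simp only [mem_support_append_iff, support_reverse, List.mem_reverse]
      grind
    · grind
  · have hX : (A₁.append (R.append A₂)).IsPath := by
      simp only [isPath_append_iff, mem_support_append_iff]
      grind
    refine ⟨p, q, A₁.append (R.append A₂), B, C, ⟨hne, hX, hB, hC,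
      Parallel.of_inner hX (x := u) (by simp) hup huq ?_,
      Parallel.of_inner hX (x := u) (by simp) hup huq ?_, hBC⟩, ?_⟩
    · simp only [mem_support_append_iff]
      grind
    · simp only [mem_support_append_iff]
      grind
    · simp only [edges_append, List.mem_append]
      grind

theorem IsTheta.hasTheta_of_handle (hG : Connected₃ G) {p q u w : V} {A B C : G.Walk p q}
    {R : G.Walk u w} (h : IsTheta A B C) (hR : R.IsPath) (hu : u ∈ A.support) (hw : w ∈ A.support)
    (hup : u ≠ p) (huq : u ≠ q) (hwp : w ≠ p) (hwq : w ≠ q)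
    (hRA : ∀ v ∈ R.support, v ∈ A.support ∨ v ∈ B.support ∨ v ∈ C.support → v = u ∨ v = w)
    {E : Set (Sym2 V)} {e₁ e₂ e₃ e₄ : Sym2 V} (h₁ : e₁ ∈ A.edges) (h₂ : e₂ ∈ B.edges)
    (h₃ : e₃ ∈ C.edges) (h₄ : e₄ ∈ R.edges) (h₁₄ : e₁ ≠ e₄)
    (hE : ∀ e ∈ E, e = e₁ ∨ e = e₂ ∨ e = e₃ ∨ e = e₄) : HasTheta G E := by
  rcases exists_append_append_of_mem A hu hw with ⟨A₁, M, A₂, rfl⟩ | ⟨A₁, M, A₂, rfl⟩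
  · exact h.hasTheta_of_handle_aux hG hR hup huq hwp hwq hRA h₁ h₂ h₃ h₄ h₁₄ hE
  · exact h.hasTheta_of_handle_aux hG hR.reverse hwp hwq hup huq
      (fun v hv hv' => (hRA v (by simpa using hv) hv').symm) h₁ h₂ h₃ (by simpa using h₄) h₁₄ hE

/-- A theta together with a path joining two inner points. -/
theorem IsTheta.hasTheta_of_ear (hG : Connected₃ G) {p q u w : V} {A B C : G.Walk p q}
    {R : G.Walk u w} (h : IsTheta A B C) (hR : R.IsPath)
    (hu : u ∈ A.support ∨ u ∈ B.support ∨ u ∈ C.support)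
    (hw : w ∈ A.support ∨ w ∈ B.support ∨ w ∈ C.support)
    (hup : u ≠ p) (huq : u ≠ q) (hwp : w ≠ p) (hwq : w ≠ q)
    (hRA : ∀ v ∈ R.support, v ∈ A.support ∨ v ∈ B.support ∨ v ∈ C.support → v = u ∨ v = w)
    {E : Set (Sym2 V)} {e₁ e₂ e₃ e₄ : Sym2 V} (h₁ : e₁ ∈ A.edges) (h₂ : e₂ ∈ B.edges)
    (h₃ : e₃ ∈ C.edges) (h₄ : e₄ ∈ R.edges) (h₁₄ : e₁ ≠ e₄) (h₂₄ : e₂ ≠ e₄) (h₃₄ : e₃ ≠ e₄)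
    (hE : ∀ e ∈ E, e = e₁ ∨ e = e₂ ∨ e = e₃ ∨ e = e₄) : HasTheta G E := by
  wlog huA : u ∈ A.support generalizing A B C e₁ e₂ e₃
  · have hu' := hu.resolve_left huA
    by_cases huB : u ∈ B.support
    · exact this h.swap (or_left_comm.1 hu) (or_left_comm.1 hw)
        (fun v hv hv' => hRA v hv (or_left_comm.1 hv')) h₂ h₁ h₃ h₂₄ h₁₄ h₃₄
        (fun e he => or_left_comm.1 (hE e he)) huB
    · exact this h.rotate.rotate (or_rotate.2 hu) (or_rotate.2 hw)
        (fun v hv hv' => hRA v hv (or_rotate.1 hv')) h₃ h₁ h₂ h₃₄ h₁₄ h₂₄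
        (fun e he => by rcases hE e he with h | h | h | h <;> simp only [h, true_or, or_true])
        (hu'.resolve_left huB)
  rcases hw with hw | hw | hw
  · exact h.hasTheta_of_handle hG hR huA hw hup huq hwp hwq hRA h₁ h₂ h₃ h₄ h₁₄ hE
  · exact h.hasTheta_of_chord hR huA hw hup huq hwp hwq hRA h₁ h₂ h₃ h₄ hE
  · exact h.rotate.rotate.swap.hasTheta_of_chord hR huA hw hup huq hwp hwq
      (fun v hv hv' => hRA v hv (hv'.imp_right Or.symm)) h₁ h₃ h₂ h₄
      (fun e he => (hE e he).imp_right or_left_comm.1)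

/-- In a cubic graph, no further path starts at an end of a theta. -/
theorem IsTheta.start_ne (hd : ∀ v, (G.neighborSet v).encard ≤ 3) {p q u w : V}
    {A B C : G.Walk p q} {R : G.Walk u w} (h : IsTheta A B C) (huw : u ≠ w)
    (hR : ∀ e ∈ R.edges, ¬(e ∈ A.edges ∨ e ∈ B.edges ∨ e ∈ C.edges)) : u ≠ p := by
  rintro rfl
  have hA := not_nil_of_ne h.ne (p := A)
  have hB := not_nil_of_ne h.ne (p := B)
  have hC := not_nil_of_ne h.ne (p := C)
  have hR' := not_nil_of_ne huw (p := R)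
  have eA := mk_start_snd_mem_edges hA
  have eB := mk_start_snd_mem_edges hB
  have eC := mk_start_snd_mem_edges hC
  have eR := hR _ (mk_start_snd_mem_edges hR')
  rcases exists_mem_edges_of_four (hd u) (A.adj_snd hA) (B.adj_snd hB) (C.adj_snd hC)
    (R.adj_snd hR') (fun h' => h.par₁₂.notMem_edges eA (h' ▸ eB))
    (fun h' => h.par₁₃.notMem_edges eA (h' ▸ eC))
    (fun h' => h.par₂₃.notMem_edges eB (h' ▸ eC)) with h' | h' | h' <;> rw [h'] at eR <;> tauto

/-- Any four edges of a cubic 3-connected graph lie on a theta. -/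
theorem hasTheta_of_four (hG : Connected₃ G) (hd : ∀ v, (G.neighborSet v).encard = 3)
    {e₁ e₂ e₃ e₄ : Sym2 V} (h₁ : e₁ ∈ G.edgeSet) (h₂ : e₂ ∈ G.edgeSet) (h₃ : e₃ ∈ G.edgeSet)
    (h₄ : e₄ ∈ G.edgeSet) : HasTheta G {e₁, e₂, e₃, e₄} := by
  have hd₁ : ∀ v, 3 ≤ (G.neighborSet v).encard := fun v => (hd v).ge
  have hd₂ : ∀ v, (G.neighborSet v).encard ≤ 3 := fun v => (hd v).le
  have hE : ∀ e ∈ ({e₁, e₂, e₃, e₄} : Set (Sym2 V)), e = e₁ ∨ e = e₂ ∨ e = e₃ ∨ e = e₄ :=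
    fun e he => he
  generalize ({e₁, e₂, e₃, e₄} : Set (Sym2 V)) = E at hE
  wlog hne : e₁ ≠ e₂ generalizing e₂
  · obtain rfl : e₁ = e₂ := not_not.1 hne
    obtain ⟨e, he, hne'⟩ : ∃ e ∈ G.edgeSet, e₁ ≠ e := by
      induction e₁ with
      | h a b =>
        have hn : (G.neighborSet a).Nontrivial := by
          rw [← Set.one_lt_encard_iff_nontrivial, hd a]
          decide
        obtain ⟨c, hc, hcb⟩ := hn.exists_ne b
        refine ⟨s(a, c), hc, fun h => ?_⟩
        exact hcb (Sym2.congr_right.1 h).symm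
    exact this he (fun e' he' => by have := hE e' he'; tauto) hne'
  obtain ⟨p, q, A, B, hAB, eA, eB⟩ := exists_bigon hG h₁ h₂ hne
  by_cases e₃A : e₃ ∈ A.edges ∨ e₃ ∈ B.edges
  · exact hAB.hasTheta hG hd₁ h₄ fun e he => by
      rcases hE e he with rfl | rfl | rfl | rfl <;> tauto
  rw [not_or] at e₃A
  obtain ⟨p', q', A', B', C, hT, eC, hedge⟩ := hAB.exists_theta hG h₃ e₃A.1 e₃A.2
  have e₁T := (hedge e₁).2 (Or.inl eA)
  have e₂T := (hedge e₂).2 (Or.inr eB)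
  clear hedge eA eB e₃A hAB
  by_cases e₁₂A : e₁ ∈ A'.edges ∧ e₂ ∈ A'.edges
  · have hAC : IsBigon A' C := ⟨hT.ne, hT.fst, hT.trd, hT.par₁₃⟩
    exact hAC.hasTheta hG hd₁ h₄ fun e he => by
      rcases hE e he with rfl | rfl | rfl | rfl <;> tauto
  by_cases e₁₂B : e₁ ∈ B'.edges ∧ e₂ ∈ B'.edges
  · have hBC : IsBigon B' C := ⟨hT.ne, hT.snd, hT.trd, hT.par₂₃⟩
    exact hBC.hasTheta hG hd₁ h₄ fun e he => by
      rcases hE e he with rfl | rfl | rfl | rfl <;> tauto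
  wlog hsplit : e₁ ∈ A'.edges ∧ e₂ ∈ B'.edges generalizing A' B'
  · exact this B' A' hT.swap e₁T.symm e₂T.symm e₁₂B e₁₂A (by tauto)
  obtain ⟨e₁A, e₂B⟩ := hsplit
  by_cases e₄T : e₄ ∈ A'.edges ∨ e₄ ∈ B'.edges ∨ e₄ ∈ C.edges
  · exact ⟨p', q', A', B', C, hT, fun e he => by
      rcases hE e he with rfl | rfl | rfl | rfl <;> tauto⟩
  have hsupp : ∀ {P : G.Walk p' q'} {x y : V}, s(x, y) ∈ P.edges → x ∈ P.support ∧ y ∈ P.support :=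
    fun h => ⟨fst_mem_support_of_mem_edges _ h, snd_mem_support_of_mem_edges _ h⟩
  obtain ⟨u, w, R, huw, hu, hw, hR, e₄R, hRS, hRF⟩ := exists_ear hG h₄
    (S := {v | v ∈ A'.support ∨ v ∈ B'.support ∨ v ∈ C.support})
    (F := {e | e ∈ A'.edges ∨ e ∈ B'.edges ∨ e ∈ C.edges})
    ⟨p', by simp, q', by simp, hT.ne⟩
    (fun x y hxy => hxy.elim (fun h => (hsupp h).imp Or.inl Or.inl) fun h => h.elim
      (fun h => (hsupp h).imp (Or.inr ∘ Or.inl) (Or.inr ∘ Or.inl))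
      (fun h => (hsupp h).imp (Or.inr ∘ Or.inr) (Or.inr ∘ Or.inr))) e₄T
  refine hT.hasTheta_of_ear hG hR hu hw (hT.start_ne hd₂ huw hRF)
    (hT.reverse.start_ne hd₂ huw (by simpa using hRF))
    (hT.start_ne hd₂ huw.symm (R := R.reverse) (by simpa using hRF))
    (hT.reverse.start_ne hd₂ huw.symm (R := R.reverse) (by simpa using hRF)) hRS e₁A e₂B eC e₄R
    ?_ ?_ ?_ hE <;> rintro rfl <;> tauto

theorem KConnected.connected₃ (h : KConnected G 3) : Connected₃ G := by
  intro s t x y hxs hxt hys hyt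
  have hS : ({s, t} : Set V).encard < ((3 : ℕ) : ℕ∞) :=
    (Set.encard_insert_le _ _).trans_lt (by rw [Set.encard_singleton]; decide)
  obtain ⟨W⟩ := (h _ hS).preconnected ⟨x, by simp [hxs, hxt]⟩ ⟨y, by simp [hys, hyt]⟩
  have key : ∀ v ∈ (W.map (Embedding.induce _).toHom).support, v ≠ s ∧ v ≠ t := by
    intro v hv
    rw [Walk.support_map, List.mem_map] at hv
    obtain ⟨⟨z, hz⟩, -, rfl⟩ := hv
    exact not_or.1 hz
  exact ⟨W.map (Embedding.induce _).toHom, fun h => (key s h).1 rfl, fun h => (key t h).2 rfl⟩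

end FourEdges

section Realization

variable {V : Type*} {G : SimpleGraph V}

theorem edgePoint_comm (v w : V) (t : ℝ) : edgePoint w v (1 - t) = edgePoint v w t := by
  classical
  ext u
  simp only [edgePoint, sub_sub_cancel]
  rw [add_comm]

/-- The tent function, which is supported in `(-1, 1)`. -/
def tent (x : ℝ) : ℝ := max 0 (1 - |x|)

theorem continuous_tent : Continuous tent := by
  unfold tent
  fun_prop

theorem tent_pos_iff {x : ℝ} : 0 < tent x ↔ |x| < 1 := by
  simp [tent]

theorem tent_of_abs_le {x : ℝ} (h : |x| ≤ 1) : tent x = 1 - |x| :=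
  max_eq_right (by linarith)

theorem tent_eq_zero {x : ℝ} (h : 1 ≤ |x|) : tent x = 0 :=
  max_eq_left (by linarith)

open Classical in
/-- The point at time `t` of the walk that traverses one edge per unit of time. -/
noncomputable def walkPoint {p q : V} (P : G.Walk p q) (t : ℝ) : V → ℝ :=
  fun u => ∑ i ∈ Finset.range (P.length + 1), if P.getVert i = u then tent (t - i) else 0

theorem continuous_walkPoint {p q : V} (P : G.Walk p q) : Continuous (walkPoint P) := by
  refine continuous_pi fun u => continuous_finsetSum _ fun i _ => ?_
  split_ifs
  · exact continuous_tent.comp (by fun_prop)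
  · exact continuous_const

theorem walkPoint_eq_edgePoint {p q : V} (P : G.Walk p q) {k : ℕ} (hk : k < P.length) {t : ℝ}
    (ht : (k : ℝ) ≤ t) (ht' : t ≤ k + 1) :
    walkPoint P t = edgePoint (P.getVert k) (P.getVert (k + 1)) (t - k) := by
  classical
  ext u
  have h1 : tent (t - k) = 1 - (t - k) := by
    rw [tent_of_abs_le] <;> rw [abs_of_nonneg] <;> linarith
  have h2 : tent (t - (k + 1)) = t - k := by
    rw [tent_of_abs_le] <;> rw [abs_of_nonpos] <;> linarith
  rw [walkPoint, Finset.sum_eq_add_of_mem k (k + 1) (by simp; lia) (by simp; lia) (by simp)]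
  · simp [edgePoint, h1, h2, eq_comm]
  · intro i _ hi
    rw [tent_eq_zero, ite_self]
    rcases lt_or_gt_of_ne hi.1 with h | h
    · have : (i : ℝ) + 1 ≤ k := by exact_mod_cast h
      rw [abs_of_nonneg] <;> linarith
    · have : (k : ℝ) + 2 ≤ i := by
        have := hi.2
        exact_mod_cast (by lia : k + 2 ≤ i)
      rw [abs_of_nonpos] <;> linarith

theorem walkPoint_getVert {p q : V} {P : G.Walk p q} (hP : P.IsPath) (t : ℝ) {j : ℕ}
    (hj : j ≤ P.length) : walkPoint P t (P.getVert j) = tent (t - j) := by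
  classical
  rw [walkPoint, Finset.sum_eq_single_of_mem j (by simp; lia)]
  · simp
  · intro i hi hij
    rw [if_neg]
    exact fun h => hij (hP.getVert_injOn (by simp at hi ⊢; lia) hj h)

theorem walkPoint_of_notMem {p q : V} (P : G.Walk p q) (t : ℝ) {u : V} (hu : u ∉ P.support) :
    walkPoint P t u = 0 := by
  classical
  refine Finset.sum_eq_zero fun i _ => if_neg ?_
  rintro rfl
  exact hu (P.getVert_mem_support i)

theorem exists_nat_lt_of_mem_Icc {n : ℕ} (hn : 0 < n) {t : ℝ} (ht : t ∈ Set.Icc 0 (n : ℝ)) :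
    ∃ k < n, (k : ℝ) ≤ t ∧ t ≤ k + 1 := by
  rcases ht.2.lt_or_eq with h | h
  · exact ⟨⌊t⌋₊, (Nat.floor_lt ht.1).2 h, Nat.floor_le ht.1, (Nat.lt_floor_add_one t).le⟩
  · refine ⟨n - 1, by lia, ?_, ?_⟩ <;> rw [Nat.cast_pred hn] <;> linarith

theorem walkPoint_mem {p q : V} (hpq : p ≠ q) (P : G.Walk p q) {t : ℝ}
    (ht : t ∈ Set.Icc 0 (P.length : ℝ)) : walkPoint P t ∈ GraphRealization G := by
  obtain ⟨k, hk, h1, h2⟩ := exists_nat_lt_of_mem_Icc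
    (not_nil_iff_lt_length.1 (not_nil_of_ne hpq)) ht
  exact Or.inr ⟨_, _, t - k, P.adj_getVert_succ hk, ⟨by linarith, by linarith⟩,
    walkPoint_eq_edgePoint P hk h1 h2⟩

theorem walkPoint_injOn {p q : V} {P : G.Walk p q} (hP : P.IsPath) :
    Set.InjOn (walkPoint P) (Set.Icc 0 (P.length : ℝ)) := by
  intro t ht s hs hts
  wlog hle : t ≤ s generalizing t s
  · exact (this hs ht hts.symm (le_of_not_ge hle)).symm
  have hk : ⌊t⌋₊ ≤ P.length := by
    exact_mod_cast (Nat.floor_le ht.1).trans ht.2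
  have h1 := Nat.floor_le ht.1
  have h2 := Nat.lt_floor_add_one t
  have h3 := congrFun hts (P.getVert ⌊t⌋₊)
  rw [walkPoint_getVert hP _ hk, walkPoint_getVert hP _ hk] at h3
  have h4 : |t - ⌊t⌋₊| < 1 := by rw [abs_of_nonneg] <;> linarith
  have h5 : |s - ⌊t⌋₊| < 1 := tent_pos_iff.1 (h3 ▸ tent_pos_iff.2 h4)
  rw [tent_of_abs_le h4.le, tent_of_abs_le h5.le, abs_of_nonneg (by linarith),
    abs_of_nonneg (by linarith)] at h3
  linarith

theorem mk_mem_edges_of_length_eq_one {p q : V} {P : G.Walk p q} (h : P.length = 1) :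
    s(p, q) ∈ P.edges := by
  have h1 := mk_start_snd_mem_edges (p := P) (not_nil_iff_lt_length.2 (by lia))
  rwa [snd, ← h, getVert_length] at h1

theorem tent_eq_one_iff {x : ℝ} : tent x = 1 ↔ x = 0 := by
  constructor
  · intro h
    have h1 : |x| < 1 := tent_pos_iff.1 (h ▸ one_pos)
    rw [tent_of_abs_le h1.le] at h
    exact abs_eq_zero.1 (by linarith)
  · rintro rfl
    simp [tent]

theorem walkPoint_start {p q : V} {P : G.Walk p q} (hP : P.IsPath) (t : ℝ) :
    walkPoint P t p = tent t := by
  simpa using walkPoint_getVert hP t (Nat.zero_le _)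

theorem walkPoint_end {p q : V} {P : G.Walk p q} (hP : P.IsPath) (t : ℝ) :
    walkPoint P t q = tent (t - P.length) := by
  simpa using walkPoint_getVert hP t le_rfl

theorem eq_or_length_eq_one_of_walkPoint {p q : V} (hpq : p ≠ q) {P : G.Walk p q} (hP : P.IsPath)
    {t : ℝ} (ht : t ∈ Set.Icc 0 (P.length : ℝ))
    (h : ∀ v ∈ P.support, walkPoint P t v ≠ 0 → v = p ∨ v = q) :
    t = 0 ∨ t = P.length ∨ P.length = 1 := by
  have key : ∀ k : ℕ, k ≤ P.length → |t - k| < 1 → k = 0 ∨ k = P.length := by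
    intro k hk hkt
    rw [← hP.getVert_eq_start_iff hk, ← hP.getVert_eq_end_iff hk]
    refine h _ (P.getVert_mem_support k) ?_
    rw [walkPoint_getVert hP _ hk]
    exact (tent_pos_iff.2 hkt).ne'
  obtain ⟨k, hk, h1, h2⟩ := exists_nat_lt_of_mem_Icc
    (not_nil_iff_lt_length.1 (not_nil_of_ne hpq)) ht
  rcases h1.eq_or_lt with rfl | h1
  · rcases key k hk.le (by simp) with rfl | h'
    · simp
    · lia
  rcases h2.eq_or_lt with rfl | h2
  · rcases key (k + 1) hk (by simp) with h' | h'
    · lia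
    · rw [← h']
      simp
  have h3 := key k hk.le (by rw [abs_lt]; constructor <;> linarith)
  have h4 := key (k + 1) hk (by push_cast; rw [abs_lt]; constructor <;> linarith)
  lia

/-- Parallel paths meet only in their ends. -/
theorem Parallel.walkPoint_eq {p q : V} (hpq : p ≠ q) {P Q : G.Walk p q} (hP : P.IsPath)
    (hQ : Q.IsPath) (h : Parallel P Q) {t s : ℝ} (ht : t ∈ Set.Icc 0 (P.length : ℝ))
    (hs : s ∈ Set.Icc 0 (Q.length : ℝ)) (hts : walkPoint P t = walkPoint Q s) :
    t = 0 ∧ s = 0 ∨ t = P.length ∧ s = Q.length := by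
  have hp : t = 0 ↔ s = 0 := by
    rw [← tent_eq_one_iff, ← tent_eq_one_iff, ← walkPoint_start hP, hts, walkPoint_start hQ]
  have hq : t = P.length ↔ s = Q.length := by
    rw [← sub_eq_zero, ← tent_eq_one_iff, ← walkPoint_end hP, hts, walkPoint_end hQ,
      tent_eq_one_iff, sub_eq_zero]
  have h1 := eq_or_length_eq_one_of_walkPoint hpq hP ht fun v hv hv' =>
    h.1 v hv (by_contra fun hn => hv' (hts ▸ walkPoint_of_notMem Q s hn))
  have h2 := eq_or_length_eq_one_of_walkPoint hpq hQ hs fun v hv hv' =>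
    h.1 v (by_contra fun hn => hv' (hts ▸ walkPoint_of_notMem P t hn)) hv
  have h3 : ¬(P.length = 1 ∧ Q.length = 1) := fun h' =>
    h.2 ⟨mk_mem_edges_of_length_eq_one h'.1, mk_mem_edges_of_length_eq_one h'.2⟩
  tauto

theorem exists_walkPoint_eq {p q : V} (P : G.Walk p q) {v w : V} (h : s(v, w) ∈ P.edges) {t : ℝ}
    (ht : t ∈ Set.Icc (0 : ℝ) 1) :
    ∃ s ∈ Set.Icc 0 (P.length : ℝ), walkPoint P s = edgePoint v w t := by
  obtain ⟨x, y, hxy, P₁, P₂, he, rfl⟩ := exists_append_cons_of_mem_edges P h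
  wlog hv : v = x ∧ w = y generalizing v w t
  · rw [← edgePoint_comm]
    rcases Sym2.eq_iff.1 he with h' | h'
    · exact absurd h' hv
    · exact this ⟨by linarith [ht.2], by linarith [ht.1]⟩ (Sym2.eq_swap.trans he)
        (by rwa [Sym2.eq_swap]) h'.symm
  obtain ⟨rfl, rfl⟩ := hv
  have hlen : P₁.length < (P₁.append (cons hxy P₂)).length := by simp
  refine ⟨P₁.length + t, ⟨by have := ht.1; positivity, ?_⟩, ?_⟩
  · have : (P₁.length : ℝ) + 1 ≤ (P₁.append (cons hxy P₂)).length := by exact_mod_cast hlen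
    linarith [ht.2]
  · rw [walkPoint_eq_edgePoint _ hlen (by linarith [ht.1]) (by linarith [ht.2])]
    simp [getVert_append]

theorem walkPoint_zero {p q : V} (hpq : p ≠ q) (P : G.Walk p q) :
    walkPoint P 0 = vertexPoint p := by
  have h := not_nil_iff_lt_length.1 (not_nil_of_ne (p := P) hpq)
  rw [walkPoint_eq_edgePoint P h (by simp) (by simp)]
  ext u
  rw [getVert_zero]
  simp [edgePoint, vertexPoint]

theorem walkPoint_length {p q : V} (hpq : p ≠ q) (P : G.Walk p q) :
    walkPoint P P.length = vertexPoint q := by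
  obtain ⟨n, hn⟩ := Nat.exists_eq_succ_of_ne_zero
    (not_nil_iff_lt_length.1 (not_nil_of_ne (p := P) hpq)).ne'
  rw [walkPoint_eq_edgePoint P (k := n) (by lia) (by simp [hn]) (by simp [hn])]
  have h : P.getVert (n + 1) = q := by rw [← Nat.succ_eq_add_one, ← hn, getVert_length]
  ext u
  rw [h]
  simp [edgePoint, vertexPoint, hn]

end Realization

section ThetaCurve

open Set

/-- The three arcs of the θ-curve, parametrized by the abscissa. -/
noncomputable def thetaArc (i : Fin 3) (x : ℝ) : ℝ × ℝ :=
  (x, (![1, -1, 0] : Fin 3 → ℝ) i * √(1 - x ^ 2))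

theorem continuous_thetaArc (i : Fin 3) : Continuous (thetaArc i) := by
  unfold thetaArc
  fun_prop

theorem thetaSet_eq_iUnion : thetaSet = ⋃ i, thetaArc i '' Icc (-1) 1 := by
  ext ⟨x, y⟩
  simp only [mem_iUnion, mem_image, thetaArc, Prod.mk.injEq, Fin.exists_fin_succ]
  simp only [thetaSet, circleAt, hSeg, mem_union, mem_ofPred_eq, sub_zero, one_pow]
  constructor
  · rintro (h | ⟨rfl, h1, h2⟩)
    · have hx : x ∈ Icc (-1 : ℝ) 1 := ⟨by nlinarith [sq_nonneg y], by nlinarith [sq_nonneg y]⟩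
      have hy : √(1 - x ^ 2) = |y| := by rw [← h, add_sub_cancel_left, Real.sqrt_sq_eq_abs]
      rcases abs_cases y with h' | h'
      · exact Or.inl ⟨x, hx, rfl, by simp [hy, h'.1]⟩
      · exact Or.inr (Or.inl ⟨x, hx, rfl, by simp [hy, h'.1]⟩)
    · exact Or.inr (Or.inr (Or.inl ⟨x, ⟨h1, h2⟩, rfl, by simp⟩))
  · rintro (⟨x, hx, rfl, rfl⟩ | ⟨x, hx, rfl, rfl⟩ | ⟨x, hx, rfl, rfl⟩ | ⟨i, _⟩)
    · left
      simp [Real.sq_sqrt (show 0 ≤ 1 - x ^ 2 by nlinarith [hx.1, hx.2])]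
    · left
      simp [Real.sq_sqrt (show 0 ≤ 1 - x ^ 2 by nlinarith [hx.1, hx.2])]
    · right
      exact ⟨by simp, hx.1, hx.2⟩
    · exact i.elim0

theorem eq_neg_one_or_eq_one_of_thetaArc_eq {i j : Fin 3} (hij : i ≠ j) {x : ℝ}
    (hx : x ∈ Icc (-1 : ℝ) 1) (h : thetaArc i x = thetaArc j x) : x = -1 ∨ x = 1 := by
  have hc : (![1, -1, 0] : Fin 3 → ℝ) i ≠ (![1, -1, 0] : Fin 3 → ℝ) j := by
    fin_cases i <;> fin_cases j <;> simp at hij ⊢ <;> norm_num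
  have h1 : √(1 - x ^ 2) = 0 := by
    by_contra h0
    exact hc (mul_right_cancel₀ h0 (congrArg Prod.snd h))
  have h2 := (Real.sqrt_eq_zero (by nlinarith [hx.1, hx.2])).1 h1
  exact (sq_eq_sq_iff_eq_or_eq_neg.1 (by linarith : x ^ 2 = 1 ^ 2)).symm

theorem thetaArc_neg_one (i : Fin 3) : thetaArc i (-1) = (-1, 0) := by
  simp [thetaArc]

theorem thetaArc_one (i : Fin 3) : thetaArc i 1 = (1, 0) := by
  simp [thetaArc]

/-- Three arcs with common ends that are otherwise disjoint form a θ-curve. -/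
theorem exists_thetaSet_homeomorph {X : Type*} [TopologicalSpace X] [T2Space X]
    (φ : Fin 3 → ℝ → X) (hcont : ∀ i, Continuous (φ i))
    (hinj : ∀ i, InjOn (φ i) (Icc (-1) 1))
    (hm : ∀ i j, φ i (-1) = φ j (-1)) (hone : ∀ i j, φ i 1 = φ j 1)
    (hne : ∀ i j, i ≠ j → ∀ x ∈ Icc (-1 : ℝ) 1, ∀ y ∈ Icc (-1 : ℝ) 1, φ i x = φ j y →
      x = -1 ∧ y = -1 ∨ x = 1 ∧ y = 1) :
    ∃ S : Set X, (∀ i, φ i '' Icc (-1) 1 ⊆ S) ∧ Nonempty (S ≃ₜ thetaSet) := by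
  classical
  set A : Fin 3 → Set (ℝ × ℝ) := fun i => thetaArc i '' Icc (-1) 1
  have hcpt : ∀ i, IsCompact (A i) := fun i => isCompact_Icc.image (continuous_thetaArc i)
  let f : ℝ × ℝ → X := fun z => if h : ∃ i, z ∈ A i then φ h.choose z.1 else φ 0 0
  have hf : ∀ i, ∀ x ∈ Icc (-1 : ℝ) 1, f (thetaArc i x) = φ i x := by
    intro i x hx
    have h : ∃ j, thetaArc i x ∈ A j := ⟨i, x, hx, rfl⟩
    have hfx : f (thetaArc i x) = φ h.choose x := dif_pos h
    rw [hfx]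
    obtain ⟨y, -, hy⟩ := h.choose_spec
    obtain rfl : y = x := congrArg Prod.fst hy
    generalize h.choose = j at hy
    rcases eq_or_ne j i with rfl | hi
    · rfl
    · rcases eq_neg_one_or_eq_one_of_thetaArc_eq hi hx hy with h' | h'
      · rw [h', hm]
      · rw [h', hone]
  have hfc : ContinuousOn f thetaSet := by
    rw [thetaSet_eq_iUnion]
    refine (locallyFinite_of_finite A).continuousOn_iUnion (fun i => (hcpt i).isClosed) fun i => ?_
    refine ((hcont i).comp continuous_fst).continuousOn.congr ?_
    rintro _ ⟨x, hx, rfl⟩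
    exact hf i x hx
  have hfi : InjOn f thetaSet := by
    rw [thetaSet_eq_iUnion]
    intro a ha b hb hab
    obtain ⟨i, x, hx, rfl⟩ := mem_iUnion.1 ha
    obtain ⟨j, y, hy, rfl⟩ := mem_iUnion.1 hb
    rw [hf i x hx, hf j y hy] at hab
    rcases eq_or_ne i j with rfl | hij
    · rw [hinj i hx hy hab]
    · rcases hne i j hij x hx y hy hab with ⟨rfl, rfl⟩ | ⟨rfl, rfl⟩
      · rw [thetaArc_neg_one, thetaArc_neg_one]
      · rw [thetaArc_one, thetaArc_one]
  have : CompactSpace thetaSet := by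
    rw [← isCompact_iff_compactSpace, thetaSet_eq_iUnion]
    exact isCompact_iUnion hcpt
  have he := (hfc.domRestrict.isClosedEmbedding hfi.injective).isEmbedding
  refine ⟨range (thetaSet.domRestrict f), ?_, ⟨he.toHomeomorph.symm⟩⟩
  rintro i _ ⟨x, hx, rfl⟩
  refine ⟨⟨thetaArc i x, ?_⟩, hf i x hx⟩
  rw [thetaSet_eq_iUnion]
  exact mem_iUnion.2 ⟨i, x, hx, rfl⟩

end ThetaCurve

section Assembly

open Set

variable {V : Type*} {G : SimpleGraph V}

/-- The increasing affine map of `[-1, 1]` onto `[0, n]`, extended by constants. -/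
noncomputable def pathTime (n : ℕ) (x : ℝ) : ℝ :=
  n * (((projIcc (-1) 1 (by norm_num) x : ℝ) + 1) / 2)

theorem continuous_pathTime (n : ℕ) : Continuous (pathTime n) := by
  unfold pathTime
  have := continuous_projIcc (a := (-1 : ℝ)) (b := 1) (h := by norm_num)
  fun_prop

theorem pathTime_of_mem (n : ℕ) {x : ℝ} (hx : x ∈ Icc (-1 : ℝ) 1) :
    pathTime n x = n * ((x + 1) / 2) := by
  rw [pathTime, projIcc_of_mem _ hx]

theorem pathTime_mem (n : ℕ) (x : ℝ) : pathTime n x ∈ Icc 0 (n : ℝ) := by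
  have h := (projIcc (-1) 1 (by norm_num : (-1 : ℝ) ≤ 1) x).2
  refine ⟨mul_nonneg n.cast_nonneg (by linarith [h.1]),
    mul_le_of_le_one_right n.cast_nonneg (by linarith [h.2])⟩

theorem pathTime_eq_zero {n : ℕ} (hn : n ≠ 0) {x : ℝ} (hx : x ∈ Icc (-1 : ℝ) 1) :
    pathTime n x = 0 ↔ x = -1 := by
  rw [pathTime_of_mem n hx, mul_eq_zero_iff_left (by exact_mod_cast hn)]
  constructor <;> intro h <;> linarith

theorem pathTime_eq_self {n : ℕ} (hn : n ≠ 0) {x : ℝ} (hx : x ∈ Icc (-1 : ℝ) 1) :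
    pathTime n x = n ↔ x = 1 := by
  rw [pathTime_of_mem n hx, mul_eq_left₀ (by exact_mod_cast hn)]
  constructor <;> intro h <;> linarith

theorem injOn_pathTime {n : ℕ} (hn : n ≠ 0) : InjOn (pathTime n) (Icc (-1) 1) := by
  intro x hx y hy h
  rw [pathTime_of_mem n hx, pathTime_of_mem n hy] at h
  have := mul_left_cancel₀ (by exact_mod_cast hn) h
  linarith

theorem exists_pathTime_eq {n : ℕ} (hn : n ≠ 0) {t : ℝ} (ht : t ∈ Icc 0 (n : ℝ)) :
    ∃ x ∈ Icc (-1 : ℝ) 1, pathTime n x = t := by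
  have hn' : (0 : ℝ) < n := by exact_mod_cast Nat.pos_of_ne_zero hn
  have h1 : 0 ≤ t / n := div_nonneg ht.1 hn'.le
  have h2 : t / n ≤ 1 := (div_le_one hn').2 ht.2
  have hx : 2 * (t / n) - 1 ∈ Icc (-1 : ℝ) 1 := ⟨by linarith, by linarith⟩
  refine ⟨_, hx, ?_⟩
  rw [pathTime_of_mem n hx]
  field_simp
  ring

/-- Three pairwise parallel paths form a θ-curve in the realization. -/
theorem IsTheta.exists_thetaSet_homeomorph {p q : V} {A B C : G.Walk p q} (h : IsTheta A B C) :
    ∃ S : Set (GraphRealization G), Nonempty (S ≃ₜ thetaSet) ∧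
      ∀ v w t, (s(v, w) ∈ A.edges ∨ s(v, w) ∈ B.edges ∨ s(v, w) ∈ C.edges) → t ∈ Icc (0 : ℝ) 1 →
        ∀ x : GraphRealization G, (x : V → ℝ) = edgePoint v w t → x ∈ S := by
  let P : Fin 3 → G.Walk p q := ![A, B, C]
  have hP : ∀ i, (P i).IsPath := by
    intro i
    fin_cases i
    exacts [h.fst, h.snd, h.trd]
  have hpar : ∀ i j, i ≠ j → Parallel (P i) (P j) := by
    intro i j hij
    fin_cases i <;> fin_cases j <;> first | exact absurd rfl hij | skip
    exacts [h.par₁₂, h.par₁₃, h.par₁₂.symm, h.par₂₃, h.par₁₃.symm, h.par₂₃.symm]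
  have hlen : ∀ i, (P i).length ≠ 0 := fun i =>
    (not_nil_iff_lt_length.1 (not_nil_of_ne h.ne)).ne'
  let φ : Fin 3 → ℝ → GraphRealization G := fun i x =>
    ⟨walkPoint (P i) (pathTime _ x), walkPoint_mem h.ne (P i) (pathTime_mem _ x)⟩
  have hl : (-1 : ℝ) ∈ Icc (-1 : ℝ) 1 := by simp
  have hr : (1 : ℝ) ∈ Icc (-1 : ℝ) 1 := by simp
  obtain ⟨S, hS, hS'⟩ := CubicTheta.exists_thetaSet_homeomorph φ
    (fun i => ((continuous_walkPoint (P i)).comp (continuous_pathTime _)).subtype_mk _)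
    (fun i x hx y hy hxy => injOn_pathTime (hlen i) hx hy
      (walkPoint_injOn (hP i) (pathTime_mem _ x) (pathTime_mem _ y) (congrArg Subtype.val hxy)))
    (fun i j => Subtype.ext (by
      simp only [φ]
      rw [(pathTime_eq_zero (hlen i) hl).2 rfl, (pathTime_eq_zero (hlen j) hl).2 rfl,
        walkPoint_zero h.ne, walkPoint_zero h.ne]))
    (fun i j => Subtype.ext (by
      simp only [φ]
      rw [(pathTime_eq_self (hlen i) hr).2 rfl, (pathTime_eq_self (hlen j) hr).2 rfl,
        walkPoint_length h.ne, walkPoint_length h.ne]))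
    (fun i j hij x hx y hy hxy => by
      have := (hpar i j hij).walkPoint_eq h.ne (hP i) (hP j) (pathTime_mem _ x) (pathTime_mem _ y)
        (congrArg Subtype.val hxy)
      rwa [pathTime_eq_zero (hlen i) hx, pathTime_eq_zero (hlen j) hy,
        pathTime_eq_self (hlen i) hx, pathTime_eq_self (hlen j) hy] at this)
  refine ⟨S, hS', fun v w t hvw ht x hx => ?_⟩
  obtain ⟨i, hi⟩ : ∃ i, s(v, w) ∈ (P i).edges := by
    rcases hvw with h' | h' | h'
    exacts [⟨0, h'⟩, ⟨1, h'⟩, ⟨2, h'⟩]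
  obtain ⟨s, hs, hs'⟩ := exists_walkPoint_eq (P i) hi ht
  obtain ⟨y, hy, rfl⟩ := exists_pathTime_eq (hlen i) hs
  exact hS i ⟨y, hy, Subtype.ext (hs'.trans hx.symm)⟩

theorem exists_eq_edgePoint (hG : ∀ v, (G.neighborSet v).Nonempty) (x : GraphRealization G) :
    ∃ v w t, G.Adj v w ∧ t ∈ Icc (0 : ℝ) 1 ∧ (x : V → ℝ) = edgePoint v w t := by
  obtain ⟨x, ⟨v, rfl⟩ | h⟩ := x
  · obtain ⟨w, hw⟩ := hG v
    refine ⟨v, w, 0, hw, by simp, ?_⟩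
    ext u
    simp [edgePoint, vertexPoint]
  · exact h

end Assembly

end CubicTheta

/-- Any four points of the realization of a 3-regular, 3-connected graph
lie on a subspace homeomorphic to a circle or to a θ-curve. -/
theorem statement15 {V : Type*} (G : SimpleGraph V)
    (hreg : ∀ v : V, (G.neighborSet v).encard = 3)
    (hconn : KConnected G 3)
    (x₀ x₁ x₂ x₃ : ↥(GraphRealization G)) :
    ∃ S : Set ↥(GraphRealization G), x₀ ∈ S ∧ x₁ ∈ S ∧ x₂ ∈ S ∧ x₃ ∈ S ∧
      (Nonempty (↥S ≃ₜ ↥unitCircleSet) ∨ Nonempty (↥S ≃ₜ ↥thetaSet)) := by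
  have hG := CubicTheta.KConnected.connected₃ hconn
  have hne : ∀ v, (G.neighborSet v).Nonempty := fun v =>
    Set.encard_ne_zero.1 (by rw [hreg]; norm_num)
  obtain ⟨v₀, w₀, t₀, h₀, ht₀, hx₀⟩ := CubicTheta.exists_eq_edgePoint hne x₀
  obtain ⟨v₁, w₁, t₁, h₁, ht₁, hx₁⟩ := CubicTheta.exists_eq_edgePoint hne x₁
  obtain ⟨v₂, w₂, t₂, h₂, ht₂, hx₂⟩ := CubicTheta.exists_eq_edgePoint hne x₂
  obtain ⟨v₃, w₃, t₃, h₃, ht₃, hx₃⟩ := CubicTheta.exists_eq_edgePoint hne x₃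
  obtain ⟨p, q, A, B, C, hABC, hE⟩ := CubicTheta.hasTheta_of_four hG hreg
    (G.mem_edgeSet.2 h₀) (G.mem_edgeSet.2 h₁) (G.mem_edgeSet.2 h₂) (G.mem_edgeSet.2 h₃)
  obtain ⟨S, hS, hx⟩ := hABC.exists_thetaSet_homeomorph
  exact ⟨S, hx _ _ _ (hE _ (by simp)) ht₀ _ hx₀, hx _ _ _ (hE _ (by simp)) ht₁ _ hx₁,
    hx _ _ _ (hE _ (by simp)) ht₂ _ hx₂, hx _ _ _ (hE _ (by simp)) ht₃ _ hx₃, Or.inr hS⟩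
end
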